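/- arXiv:1501.06865 — 2 statements merged into one kernel-verified Lean document; each statement's English description precedes it below -/
import Mathlib

section
/- Let d = 1 and let V : ℝ → ℝ be bounded and measurable. Suppose there exist L(1), L(-1) ∈ ℝ such that lim_{r→+∞} r²V(rω) = L(ω) for ω ∈ {+1,-1}. Then lim_{E↑0} (|ln|E||)^{-1} N(E;V) = (1/(2π)) [ (L(1) + 1/4)_-^{1/2} + (L(-1) + 1/4)_-^{1/2} ]. If, moreover, min{L(1), L(-1)} > -1/4, then N(0;V) < ∞. -/
open MeasureTheory Filter Real Set Topology

noncomputable section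

/-- Glazman variational count of eigenvalues of `-d²/dx² + V` below `E`, `d = 1`. -/
noncomputable def schN1 (V : ℝ → ℝ) (E : ℝ) : ℕ∞ :=
  ⨆ F : {F : Submodule ℝ (ℝ → ℝ) //
      (∀ u ∈ F, ContDiff ℝ (⊤ : ℕ∞) u ∧ HasCompactSupport u) ∧
      (∀ u ∈ F, u ≠ 0 →
        (∫ x, (deriv u x ^ 2 + V x * u x ^ 2)) < E * ∫ x, u x ^ 2)},
    (Module.finrank ℝ F.1 : ℕ∞)

/-- The symbol class `S_{m,ρ}(ℝ)`. -/
def SClass1 (m : ℕ) (ρ : ℝ) (W : ℝ → ℝ) : Prop :=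
  ContDiff ℝ m W ∧ ∃ C : ℝ, 0 < C ∧ ∀ k : ℕ, k ≤ m → ∀ x : ℝ,
    |iteratedDeriv k W x| ≤ C * (1 + |x|) ^ (-ρ - (k : ℝ))

/-- Admissibility of `η` with mean value `η₀`, witnessed by the solution `φ` of `φ'' = η - η₀`. -/
structure IsAdmissible1 (η : ℝ → ℝ) (η₀ : ℝ) (φ : ℝ → ℝ) : Prop where
  background_ne : ∃ x, η x ≠ η₀
  smooth : ContDiff ℝ 2 φ
  bounded : ∃ M : ℝ, ∀ x, |φ x| ≤ M ∧ |deriv φ x| ≤ M ∧ |deriv (deriv φ) x| ≤ M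
  poisson : ∀ x, deriv (deriv φ) x = η x - η₀
  normalized :
    Filter.limsup (fun R : ℝ => (∫ x in Set.Ioo (-(R/2)) (R/2), φ x) / R) Filter.atTop = 0


/-- Bounded measurable potentials. -/
structure Pot (W : ℝ → ℝ) : Prop where
  meas : Measurable W
  bdd : ∃ M : ℝ, ∀ x, |W x| ≤ M

/-- The energy density. -/
def en (W u : ℝ → ℝ) (x : ℝ) : ℝ := deriv u x ^ 2 + W x * u x ^ 2

/-- Smooth compactly supported functions. -/
def Tst (u : ℝ → ℝ) : Prop := ContDiff ℝ (⊤ : ℕ∞) u ∧ HasCompactSupport u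

lemma Tst.c1 {u : ℝ → ℝ} (h : Tst u) : ContDiff ℝ 1 u := h.1.of_le (by exact_mod_cast le_top)

lemma Pot.sub_const {W : ℝ → ℝ} (h : Pot W) (E : ℝ) : Pot (fun x => W x - E) := by
  obtain ⟨hm, M, hM⟩ := h
  refine ⟨hm.sub_const E, M + |E|, fun x => ?_⟩
  exact (abs_sub _ _).trans (add_le_add (hM x) le_rfl)

lemma Pot.comp_neg {W : ℝ → ℝ} (h : Pot W) : Pot (fun x => W (-x)) := by
  obtain ⟨hm, M, hM⟩ := h
  exact ⟨hm.comp measurable_neg, M, fun x => hM _⟩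

lemma cs_sq {f : ℝ → ℝ} (h : HasCompactSupport f) : HasCompactSupport (fun x => f x ^ 2) := by
  refine h.mono ?_
  intro x hx hf
  exact hx (by simp [hf])

lemma en_ii {W : ℝ → ℝ} (hW : Pot W) {u : ℝ → ℝ} (hu : ContDiff ℝ 1 u) (a b : ℝ) :
    IntervalIntegrable (en W u) volume a b := by
  obtain ⟨hm, M, hM⟩ := hW
  have hd : Continuous (deriv u) := hu.continuous_deriv le_rfl
  have hc : Continuous u := hu.continuous
  have h1 : IntervalIntegrable (fun x => deriv u x ^ 2) volume a b :=
    (hd.pow 2).intervalIntegrable a b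
  have h2 : IntervalIntegrable (fun x => u x ^ 2) volume a b := (hc.pow 2).intervalIntegrable a b
  have h3 : IntervalIntegrable (fun x => W x * u x ^ 2) volume a b := by
    rw [intervalIntegrable_iff] at h2 ⊢
    exact Integrable.bdd_mul (c := M) h2 hm.aestronglyMeasurable
      (Eventually.of_forall fun x => hM x)
  exact h1.add h3

lemma en_int {W : ℝ → ℝ} (hW : Pot W) {u : ℝ → ℝ} (hu : Tst u) :
    Integrable (en W u) := by
  obtain ⟨hm, M, hM⟩ := hW
  have hd : Continuous (deriv u) := hu.c1.continuous_deriv le_rfl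
  have hc : Continuous u := hu.c1.continuous
  have i1 : Integrable (fun x => deriv u x ^ 2) := by
    refine Continuous.integrable_of_hasCompactSupport (by fun_prop) ?_
    exact cs_sq hu.2.deriv
  have i2 : Integrable (fun x => u x ^ 2) := by
    refine Continuous.integrable_of_hasCompactSupport (by fun_prop) ?_
    exact cs_sq hu.2
  have i3 : Integrable (fun x => W x * u x ^ 2) :=
    Integrable.bdd_mul (c := M) i2 hm.aestronglyMeasurable (Eventually.of_forall fun x => hM x)
  exact i1.add i3

lemma sq_int {u : ℝ → ℝ} (hu : Tst u) : Integrable (fun x => u x ^ 2) := by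
  have hc : Continuous u := hu.c1.continuous
  refine Continuous.integrable_of_hasCompactSupport (by fun_prop) ?_
  exact cs_sq hu.2

lemma en_shift {V : ℝ → ℝ} (hV : Pot V) {u : ℝ → ℝ} (hu : Tst u) (E : ℝ) :
    ∫ x, en (fun x => V x - E) u x =
      (∫ x, (deriv u x ^ 2 + V x * u x ^ 2)) - E * ∫ x, u x ^ 2 := by
  change _ = (∫ x, en V u x) - _
  rw [← integral_const_mul, ← integral_sub (en_int hV hu) ((sq_int hu).const_mul E)]
  congr 1; ext x; simp only [en]; ring

/-- Picone / Riccati inequality. -/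
lemma picone {W : ℝ → ℝ} (hW : Pot W) {u : ℝ → ℝ} (hu : ContDiff ℝ 1 u) {a b : ℝ} (hab : a ≤ b)
    (h h' : ℝ → ℝ) (hd : ∀ x ∈ Icc a b, HasDerivAt h (h' x) x) (hc : ContinuousOn h' (Icc a b))
    (hWh : ∀ x ∈ Icc a b, h' x + h x ^ 2 ≤ W x) (ua : u a = 0) (ub : u b = 0) :
    0 ≤ ∫ x in a..b, en W u x := by
  have hdu : ∀ x, HasDerivAt u (deriv u x) x := fun x =>
    (hu.differentiable one_ne_zero x).hasDerivAt
  have hcd : Continuous (deriv u) := hu.continuous_deriv le_rfl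
  have hcu : Continuous u := hu.continuous
  have hch : ContinuousOn h (Icc a b) := fun x hx => (hd x hx).continuousAt.continuousWithinAt
  have ii : IntervalIntegrable (fun x => h' x * u x ^ 2 + h x * (2 * u x * deriv u x))
      volume a b := by
    apply ContinuousOn.intervalIntegrable
    rw [uIcc_of_le hab]
    fun_prop
  have e0 : ∫ x in a..b, (h' x * u x ^ 2 + h x * (2 * u x * deriv u x)) = 0 := by
    rw [intervalIntegral.integral_eq_sub_of_hasDerivAt (f := fun x => h x * u x ^ 2) _ ii]
    · simp [ua, ub]
    · intro x hx
      rw [uIcc_of_le hab] at hx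
      have := (hd x hx).mul ((hdu x).pow 2)
      refine this.congr_deriv ?_
      simp only [Pi.pow_apply]
      norm_num
  rw [← e0]
  refine intervalIntegral.integral_mono_on hab ii (en_ii hW hu a b) fun x hx => ?_
  have := hWh x hx
  simp only [en]
  nlinarith [sq_nonneg (deriv u x - h x * u x), mul_le_mul_of_nonneg_right this (sq_nonneg (u x))]

/-- Counting predicate on intervals. -/
def PI (W : ℝ → ℝ) (a b : ℝ) (n : ℕ) : Prop :=
  ∃ S : Finset ℝ, S.card ≤ n ∧ ∀ u : ℝ → ℝ, ContDiff ℝ 1 u → u a = 0 → (∀ x ∈ S, u x = 0) →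
    u b = 0 ∧ 0 ≤ ∫ x in a..b, en W u x

lemma PI.concat {W : ℝ → ℝ} (hW : Pot W) {a b c : ℝ} {n m : ℕ} (h1 : PI W a b n)
    (h2 : PI W b c m) : PI W a c (n + m) := by
  classical
  obtain ⟨S, hS, h1⟩ := h1
  obtain ⟨T, hT, h2⟩ := h2
  refine ⟨S ∪ T, (Finset.card_union_le _ _).trans (add_le_add hS hT), fun u hu ua hv => ?_⟩
  obtain ⟨ub, e1⟩ := h1 u hu ua fun x hx => hv x (Finset.mem_union_left _ hx)
  obtain ⟨uc, e2⟩ := h2 u hu ub fun x hx => hv x (Finset.mem_union_right _ hx)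
  refine ⟨uc, ?_⟩
  rw [← intervalIntegral.integral_add_adjacent_intervals (en_ii hW hu a b) (en_ii hW hu b c)]
  exact add_nonneg e1 e2

lemma PI.iter {W : ℝ → ℝ} (hW : Pot W) (x : ℕ → ℝ) (n : ℕ)
    (h : ∀ j < n, PI W (x j) (x (j + 1)) 1) : PI W (x 0) (x n) n := by
  induction n with
  | zero => exact ⟨∅, by simp, fun u hu ua _ => ⟨ua, by simp⟩⟩
  | succ n ih => exact (ih fun j hj => h j (by omega)).concat hW (h n (by omega))

lemma PI.single {W : ℝ → ℝ} (hW : Pot W) {a b : ℝ} (hab : a ≤ b)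
    (h h' : ℝ → ℝ) (hd : ∀ x ∈ Icc a b, HasDerivAt h (h' x) x) (hc : ContinuousOn h' (Icc a b))
    (hWh : ∀ x ∈ Icc a b, h' x + h x ^ 2 ≤ W x) : PI W a b 1 :=
  ⟨{b}, by simp, fun u hu ua hv =>
    ⟨hv b (by simp), picone hW hu hab h h' hd hc hWh ua (hv b (by simp))⟩⟩

/-- Interval in the inner region. -/
lemma PI.inner {W : ℝ → ℝ} (hW : Pot W) {k : ℝ} (hk : 0 < k) {a b : ℝ} (hab : a ≤ b)
    (hb : k * (b - a) ≤ 1) (hWk : ∀ x ∈ Icc a b, -k ^ 2 ≤ W x) : PI W a b 1 := by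
  have hcos : ∀ x ∈ Icc a b, 0 < cos (k * (x - a) - 1 / 2) := fun x hx => by
    apply cos_pos_of_mem_Ioo
    have h1 : 0 ≤ k * (x - a) := mul_nonneg hk.le (by linarith [hx.1])
    have h2 : k * (x - a) ≤ k * (b - a) := by gcongr; exact hx.2
    constructor <;> linarith [Real.pi_gt_three]
  refine PI.single hW hab (fun x => - k * tan (k * (x - a) - 1 / 2))
    (fun x => - k * (1 / cos (k * (x - a) - 1 / 2) ^ 2 * k)) ?_ ?_ ?_
  · intro x hx
    have h1 : HasDerivAt (fun x => k * (x - a) - 1 / 2) k x := by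
      simpa using (((hasDerivAt_id x).sub_const a).const_mul k).sub_const (1 / 2)
    exact ((Real.hasDerivAt_tan (hcos x hx).ne').comp x h1).const_mul (-k)
  · have : ∀ x ∈ Icc a b, cos (k * (x - a) - 1 / 2) ^ 2 ≠ 0 := fun x hx =>
      pow_ne_zero _ (hcos x hx).ne'
    fun_prop (disch := assumption)
  · intro x hx
    have h1 := hcos x hx
    refine le_trans (le_of_eq ?_) (hWk x hx)
    simp only [Real.tan_eq_sin_div_cos]
    have := Real.sin_sq_add_cos_sq (k * (x - a) - 1 / 2)
    generalize hz : k * (x - a) - 1 / 2 = z at *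
    field_simp
    linear_combination this

/-- Interval in the scaling region. -/
lemma PI.mid {W : ℝ → ℝ} (hW : Pot W) {b l : ℝ} (hb : 0 < b) (hl : 0 < l) (hbl : b * l < π)
    {r : ℝ} (hr : 0 < r)
    (hWk : ∀ x, r ≤ x → -(1 / 4 + b ^ 2) / x ^ 2 ≤ W x) : PI W r (r * exp l) 1 := by
  have hx0 : ∀ x ∈ Icc r (r * exp l), 0 < x := fun x hx => hr.trans_le hx.1
  have hab : r ≤ r * exp l := by
    have : 1 ≤ exp l := Real.one_le_exp hl.le
    nlinarith
  have hcos : ∀ x ∈ Icc r (r * exp l), 0 < cos (b * (log x - log r - l / 2)) := fun x hx => by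
    apply cos_pos_of_mem_Ioo
    have h1 : log r ≤ log x := Real.log_le_log hr hx.1
    have h2 : log x ≤ log r + l := by
      have := Real.log_le_log (hx0 x hx) hx.2
      rwa [Real.log_mul hr.ne' (exp_pos l).ne', Real.log_exp] at this
    constructor
    · nlinarith
    · nlinarith
  refine PI.single hW hab
    (fun x => 1 / 2 * x⁻¹ - b * (x⁻¹ * tan (b * (log x - log r - l / 2))))
    (fun x => 1 / 2 * (-(x ^ 2)⁻¹) - b * (-(x ^ 2)⁻¹ * tan (b * (log x - log r - l / 2)) +
      x⁻¹ * (1 / cos (b * (log x - log r - l / 2)) ^ 2 * (b * x⁻¹)))) ?_ ?_ ?_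
  · intro x hx
    have hx' := (hx0 x hx).ne'
    have h1 : HasDerivAt (fun x => b * (log x - log r - l / 2)) (b * x⁻¹) x :=
      (((Real.hasDerivAt_log hx').sub_const _).sub_const _).const_mul b
    have h2 := (Real.hasDerivAt_tan (hcos x hx).ne').comp x h1
    have h3 := hasDerivAt_inv hx'
    exact (h3.const_mul _).sub ((h3.mul h2).const_mul b)
  · have c1 : ∀ x ∈ Icc r (r * exp l), cos (b * (log x - log r - l / 2)) ^ 2 ≠ 0 := fun x hx =>
      pow_ne_zero _ (hcos x hx).ne'
    have c2 : ∀ x ∈ Icc r (r * exp l), cos (b * (log x - log r - l / 2)) ≠ 0 := fun x hx =>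
      (hcos x hx).ne'
    have c3 : ∀ x ∈ Icc r (r * exp l), x ≠ 0 := fun x hx => (hx0 x hx).ne'
    have c4 : ∀ x ∈ Icc r (r * exp l), x ^ 2 ≠ 0 := fun x hx => pow_ne_zero _ (hx0 x hx).ne'
    simp only [Real.tan_eq_sin_div_cos]
    fun_prop (disch := assumption)
  · intro x hx
    have h1 := hcos x hx
    have h0 := hx0 x hx
    refine le_trans (le_of_eq ?_) (hWk x hx.1)
    simp only [Real.tan_eq_sin_div_cos]
    have := Real.sin_sq_add_cos_sq (b * (log x - log r - l / 2))
    generalize hz : b * (log x - log r - l / 2) = z at *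
    field_simp
    linear_combination (16 * b^2 : ℝ) * this

/-- Counting predicate on the half line. -/
def HL (W : ℝ → ℝ) (n : ℕ) : Prop :=
  ∃ S : Finset ℝ, S.card ≤ n ∧ ∀ u : ℝ → ℝ, Tst u → u 0 = 0 → (∀ x ∈ S, u x = 0) →
    0 ≤ ∫ x in Ioi 0, en W u x

lemma HL.of_tail {W : ℝ → ℝ} (hW : Pot W) {A : ℝ} (hA : 0 ≤ A) {n : ℕ} (h1 : PI W 0 A n)
    (h2 : ∀ u : ℝ → ℝ, Tst u → u A = 0 → 0 ≤ ∫ x in Ioi A, en W u x) : HL W n := by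
  obtain ⟨S, hS, h1⟩ := h1
  refine ⟨S, hS, fun u hu u0 hv => ?_⟩
  obtain ⟨uA, e1⟩ := h1 u hu.c1 u0 hv
  have e2 := h2 u hu uA
  have hi := en_int hW hu
  rw [← Ioc_union_Ioi_eq_Ioi hA, setIntegral_union (Ioc_disjoint_Ioi le_rfl) measurableSet_Ioi
    hi.integrableOn hi.integrableOn, ← intervalIntegral.integral_of_le hA]
  exact add_nonneg e1 e2

lemma PI.inner_iter {W : ℝ → ℝ} (hW : Pot W) {k : ℝ} (hk : 0 < k) (n : ℕ)
    (hWk : ∀ x, -k ^ 2 ≤ W x) : PI W 0 (n / k) n := by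
  have := PI.iter hW (fun j : ℕ => (j : ℝ) / k) n fun j _ => by
    refine PI.inner hW hk ?_ ?_ fun x _ => hWk x
    · push_cast; gcongr; linarith
    · push_cast; field_simp; linarith
  simpa using this

lemma tail_pos {W : ℝ → ℝ} {A : ℝ} (h : ∀ x, A ≤ x → 0 ≤ W x) (u : ℝ → ℝ) :
    0 ≤ ∫ x in Ioi A, en W u x := by
  refine setIntegral_nonneg measurableSet_Ioi fun x hx => ?_
  have := h x (le_of_lt hx)
  simp only [en]; positivity

lemma tail_hardy {W : ℝ → ℝ} (hW : Pot W) {A : ℝ} (hA : 0 < A)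
    (h : ∀ x, A ≤ x → -(1 / 4) / x ^ 2 ≤ W x) (u : ℝ → ℝ) (hu : Tst u) (uA : u A = 0) :
    0 ≤ ∫ x in Ioi A, en W u x := by
  obtain ⟨Y, hAY, hY⟩ : ∃ Y, A ≤ Y ∧ ∀ x, Y ≤ x → x ∉ tsupport u := by
    obtain ⟨B, hB⟩ := hu.2.isCompact.bddAbove
    refine ⟨max A (B + 1), le_max_left _ _, fun x hx hxu => ?_⟩
    have := hB hxu
    have := (le_max_right A (B + 1)).trans hx
    linarith
  have hi := en_int hW hu
  have e0 : ∫ x in Ioi Y, en W u x = 0 := by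
    refine setIntegral_eq_zero_of_forall_eq_zero fun x hx => ?_
    have h1 := hY x (le_of_lt hx)
    have h2 : deriv u x = 0 := by
      by_contra h0
      exact h1 (support_deriv_subset h0)
    simp [en, h2, image_eq_zero_of_notMem_tsupport h1]
  rw [← Ioc_union_Ioi_eq_Ioi hAY, setIntegral_union (Ioc_disjoint_Ioi le_rfl) measurableSet_Ioi
    hi.integrableOn hi.integrableOn, ← intervalIntegral.integral_of_le hAY, e0, add_zero]
  refine picone hW hu.c1 hAY (fun x => 1 / 2 * x⁻¹) (fun x => 1 / 2 * (-(x ^ 2)⁻¹)) ?_ ?_ ?_ uA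
    (image_eq_zero_of_notMem_tsupport (hY Y le_rfl))
  · intro x hx
    exact (hasDerivAt_inv (hA.trans_le hx.1).ne').const_mul _
  · have c4 : ∀ x ∈ Icc A Y, x ^ 2 ≠ 0 := fun x hx => pow_ne_zero _ (hA.trans_le hx.1).ne'
    fun_prop (disch := assumption)
  · intro x hx
    refine le_trans (le_of_eq ?_) (h x hx.1)
    have := hA.trans_le hx.1
    field_simp
    norm_num

lemma Pot.exists_k {V : ℝ → ℝ} (hV : Pot V) : ∃ k : ℝ, 0 < k ∧ ∀ x, -k ^ 2 ≤ V x := by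
  obtain ⟨-, M, hM⟩ := hV
  refine ⟨|M| + 1, by positivity, fun x => ?_⟩
  have := neg_le_of_abs_le (hM x)
  nlinarith [abs_nonneg M, le_abs_self M]

lemma exists_R {V : ℝ → ℝ} {L c : ℝ} (hL : Tendsto (fun r : ℝ => r ^ 2 * V r) atTop (𝓝 L))
    (hc : -c < L) {k : ℝ} (hk : 0 < k) :
    ∃ n : ℕ, 0 < (n : ℝ) / k ∧ ∀ x, (n : ℝ) / k ≤ x → -c / x ^ 2 ≤ V x := by
  obtain ⟨R0, hR0⟩ := eventually_atTop.1 (hL.eventually (lt_mem_nhds hc))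
  obtain ⟨n, hn⟩ := exists_nat_ge (k * max R0 1)
  have h1 : max R0 1 ≤ (n : ℝ) / k := by rw [le_div_iff₀ hk]; linarith
  have h2 : (0 : ℝ) < (n : ℝ) / k := lt_of_lt_of_le (by positivity) h1
  refine ⟨n, h2, fun x hx => ?_⟩
  have h3 := hR0 x ((le_max_left _ _).trans (h1.trans hx))
  have hx0 : 0 < x := h2.trans_le hx
  rw [div_le_iff₀ (by positivity)]
  linarith

lemma HL_zero {V : ℝ → ℝ} (hV : Pot V) {L : ℝ}
    (hL : Tendsto (fun r : ℝ => r ^ 2 * V r) atTop (𝓝 L)) (h : -(1 / 4) < L) :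
    ∃ n, HL V n := by
  obtain ⟨k, hk, hVk⟩ := hV.exists_k
  obtain ⟨n, hn, hR⟩ := exists_R hL h hk
  exact ⟨n, HL.of_tail hV hn.le (PI.inner_iter hV hk n hVk) (tail_hardy hV hn hR)⟩

lemma upper_right {V : ℝ → ℝ} (hV : Pot V) {L : ℝ}
    (hL : Tendsto (fun r : ℝ => r ^ 2 * V r) atTop (𝓝 L)) {l : ℝ} (hl : 0 < l)
    (h : sqrt (max (-(L + 1 / 4)) 0) < π / l) :
    ∃ C : ℝ, ∀ E : ℝ, -1 < E → E < 0 → ∃ n : ℕ, HL (fun x => V x - E) n ∧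
      (n : ℝ) ≤ |log (|E|)| / (2 * l) + C := by
  obtain ⟨b, hb1, hb2⟩ := exists_between h
  have hb : 0 < b := (sqrt_nonneg _).trans_lt hb1
  rw [Real.sqrt_lt' hb] at hb1
  have hb1 : -(1 / 4 + b ^ 2) < L := by linarith [le_max_left (-(L + 1 / 4)) 0]
  have hbl : b * l < π := by rwa [lt_div_iff₀ hl] at hb2
  obtain ⟨k, hk, hVk⟩ := hV.exists_k
  obtain ⟨N, hN, hR⟩ := exists_R hL hb1 hk
  set R : ℝ := N / k with hRdef
  set K : ℝ := sqrt (1 / 4 + b ^ 2) with hK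
  have hKpos : 0 < K := sqrt_pos.2 (by positivity)
  have hK2 : K ^ 2 = 1 / 4 + b ^ 2 := sq_sqrt (by positivity)
  refine ⟨|log (K / R)| / l + 1 + N, fun E hE1 hE0 => ?_⟩
  set n : ℕ := ⌈|log (|E|)| / (2 * l) + |log (K / R)| / l⌉₊ with hn
  have hW := hV.sub_const E
  have harg : 0 ≤ |log (|E|)| / (2 * l) + |log (K / R)| / l := by positivity
  have hn1 : (n : ℝ) < |log (|E|)| / (2 * l) + |log (K / R)| / l + 1 := Nat.ceil_lt_add_one harg
  have hn2 : |log (|E|)| / (2 * l) + |log (K / R)| / l ≤ n := Nat.le_ceil _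
  refine ⟨N + n, ?_, by push_cast; linarith⟩
  have hVW : ∀ x, V x ≤ V x - E := fun x => by linarith
  have p1 : PI (fun x => V x - E) 0 R N :=
    PI.inner_iter hW hk N fun x => (hVk x).trans (hVW x)
  have p2 : PI (fun x => V x - E) R (R * exp (n * l)) n := by
    have := PI.iter hW (fun j : ℕ => R * exp (j * l)) n fun j _ => by
      have hm := PI.mid hW hb hl hbl (r := R * exp (j * l)) (by positivity) fun x hx => by
        refine (hR x (le_trans ?_ hx)).trans (hVW x)
        have : 1 ≤ exp (j * l) := one_le_exp (by positivity)
        nlinarith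
      convert hm using 1
      rw [mul_assoc, ← exp_add]; push_cast; ring_nf
    simpa using this
  refine HL.of_tail hW (by positivity) (p1.concat hW p2) fun u hu _ => tail_pos (fun x hx => ?_) u
  have hAR : R ≤ R * exp (n * l) := by
    have : 1 ≤ exp (n * l) := one_le_exp (by positivity)
    nlinarith
  have hx0 : 0 < x := hN.trans_le (hAR.trans hx)
  have hEpos : 0 < |E| := abs_pos.2 hE0.ne
  have hlogE : log (|E|) < 0 := log_neg hEpos (by rw [abs_of_neg hE0]; linarith)
  -- K^2 ≤ |E| x^2
  have key : K ^ 2 ≤ |E| * x ^ 2 := by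
    have h1 : log K - log R ≤ |log (K / R)| := by
      rw [← log_div hKpos.ne' hN.ne']; exact le_abs_self _
    have h2 : log R + n * l ≤ log x := by
      have := log_le_log (by positivity) hx
      rwa [log_mul hN.ne' (exp_pos _).ne', log_exp] at this
    have h3 : |log (|E|)| / 2 + |log (K / R)| ≤ n * l := by
      have := mul_le_mul_of_nonneg_right hn2 hl.le
      refine le_trans (le_of_eq ?_) this
      field_simp
    rw [abs_of_neg hlogE] at h3
    have h4 : 2 * log K ≤ log (|E|) + 2 * log x := by linarith
    rw [← Real.log_le_log_iff (by positivity) (by positivity), log_mul hEpos.ne' (by positivity),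
      log_pow, log_pow]
    exact_mod_cast h4
  have h5 := hR x (hAR.trans hx)
  rw [← hK2] at h5
  have h6 : -|E| ≤ -K ^ 2 / x ^ 2 := by
    rw [le_div_iff₀ (by positivity)]; linarith
  rw [abs_of_neg hE0] at h6
  linarith

lemma schN1_le {V : ℝ → ℝ} (hV : Pot V) {E : ℝ} {n m : ℕ} (h1 : HL (fun x => V x - E) n)
    (h2 : HL (fun x => V (-x) - E) m) : schN1 V E ≤ ((n + m + 1 : ℕ) : ℕ∞) := by
  classical
  obtain ⟨S, hS, h1⟩ := h1
  obtain ⟨T, hT, h2⟩ := h2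
  set U : Finset ℝ := insert 0 (S ∪ T.image (fun x => -x)) with hU
  have hUc : U.card ≤ n + m + 1 := by
    refine (Finset.card_insert_le _ _).trans ?_
    have := Finset.card_union_le S (T.image (fun x => -x))
    have := Finset.card_image_le (s := T) (f := fun x => -x)
    omega
  refine iSup_le fun ⟨F, hF1, hF2⟩ => ?_
  have hinj : Module.finrank ℝ F ≤ U.card := by
    let ev : F →ₗ[ℝ] (U → ℝ) :=
      { toFun := fun u x => u.1 x
        map_add' := fun u v => rfl
        map_smul' := fun c u => rfl }
    have : Function.Injective ev := by
      rw [injective_iff_map_eq_zero]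
      intro u hu
      by_contra hne
      have hu0 : u.1 ≠ 0 := fun h => hne (Subtype.ext h)
      have hvan : ∀ x ∈ U, u.1 x = 0 := fun x hx => congrFun hu ⟨x, hx⟩
      have ht : Tst u.1 := hF1 u.1 u.2
      have hlt := hF2 u.1 u.2 hu0
      have hsh := en_shift hV ht E
      have hneg : ∫ x, en (fun x => V x - E) u.1 x < 0 := by rw [hsh]; linarith
      have z0 : u.1 0 = 0 := hvan 0 (by simp [hU])
      have e1 := h1 u.1 ht z0 fun x hx => hvan x (by simp [hU, hx])
      have ht' : Tst (fun x => u.1 (-x)) :=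
        ⟨ht.1.comp contDiff_neg, ht.2.comp_homeomorph (Homeomorph.neg ℝ)⟩
      have e2 := h2 (fun x => u.1 (-x)) ht' (by simpa using z0) fun x hx => hvan (-x) (by
        simp [hU, hx])
      have e3 : ∫ x in Ioi (0:ℝ), en (fun x => V (-x) - E) (fun x => u.1 (-x)) x =
          ∫ x in Iic (0:ℝ), en (fun x => V x - E) u.1 x := by
        have := integral_comp_neg_Ioi (0:ℝ) (en (fun x => V x - E) u.1)
        rw [neg_zero] at this
        rw [← this]
        congr 1; ext x
        simp only [en]
        rw [deriv_comp_neg]; ring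
      rw [e3] at e2
      have e4 := integral_add_compl (measurableSet_Ioi (a := (0:ℝ))) (en_int (hV.sub_const E) ht)
      rw [compl_Ioi] at e4
      linarith
    have := LinearMap.finrank_le_finrank_of_injective this
    simpa using this
  exact_mod_cast hinj.trans hUc

lemma sum_sq_of_orth {ι : Type*} [Fintype ι] (a : ι → ℝ) (h : ∀ i j, i ≠ j → a i * a j = 0) :
    (∑ i, a i) ^ 2 = ∑ i, a i ^ 2 := by
  classical
  rw [sq, Finset.sum_mul_sum]
  refine Finset.sum_congr rfl fun i _ => ?_
  rw [Finset.sum_eq_single i (fun j _ hj => h i j (Ne.symm hj)) (by simp), sq]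

/-- Abstract lower bound through disjointly supported test functions. -/
lemma le_schN1 {V : ℝ → ℝ} (hV : Pot V) {E : ℝ} {ι : Type*} [Fintype ι] (u : ι → ℝ → ℝ)
    (ht : ∀ i, Tst (u i)) (hd : ∀ i j, i ≠ j → Disjoint (tsupport (u i)) (tsupport (u j)))
    (hneg : ∀ i, ∫ x, en (fun x => V x - E) (u i) x < 0) :
    ((Fintype.card ι : ℕ) : ℕ∞) ≤ schN1 V E := by
  classical
  have hW := hV.sub_const E
  have o1 : ∀ i j, i ≠ j → ∀ x, u i x * u j x = 0 := fun i j hij x => by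
    by_contra h
    have h1 : x ∈ tsupport (u i) := subset_tsupport _ (left_ne_zero_of_mul h)
    have h2 : x ∈ tsupport (u j) := subset_tsupport _ (right_ne_zero_of_mul h)
    exact Set.disjoint_left.1 (hd i j hij) h1 h2
  have o2 : ∀ i j, i ≠ j → ∀ x, deriv (u i) x * deriv (u j) x = 0 := fun i j hij x => by
    by_contra h
    have h1 : x ∈ tsupport (u i) := support_deriv_subset (left_ne_zero_of_mul h)
    have h2 : x ∈ tsupport (u j) := support_deriv_subset (right_ne_zero_of_mul h)
    exact Set.disjoint_left.1 (hd i j hij) h1 h2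
  have hne : ∀ i, ∃ x, u i x ≠ 0 := fun i => by
    by_contra! h
    have h0 : u i = fun _ => 0 := funext h
    have := hneg i
    simp [h0, en] at this
  have hli : LinearIndependent ℝ u := by
    rw [Fintype.linearIndependent_iff]
    intro c hc i
    obtain ⟨x, hx⟩ := hne i
    have h1 := congrFun hc x
    simp only [Finset.sum_apply, Pi.smul_apply, smul_eq_mul, Pi.zero_apply] at h1
    rw [Finset.sum_eq_single i (fun j _ hj => by
      have := o1 j i hj x
      rw [(mul_eq_zero.1 this).resolve_right hx, mul_zero]) (by simp)] at h1
    exact (mul_eq_zero.1 h1).resolve_right hx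
  have htc : ∀ c : ι → ℝ, Tst (∑ i, c i • u i) := fun c => by
    constructor
    · have : ContDiff ℝ (⊤ : ℕ∞) (fun x => ∑ i, (c i • u i) x) :=
        ContDiff.sum fun i _ => (ht i).1.const_smul (c i)
      convert this using 1
      ext x; simp
    · refine Finset.sum_induction _ HasCompactSupport (fun f g hf hg => hf.add hg)
        HasCompactSupport.zero fun i _ => ?_
      exact (ht i).2.smul_left (f := fun _ => c i)
  have hen : ∀ c : ι → ℝ, ∫ x, en (fun x => V x - E) (∑ i, c i • u i) x =
      ∑ i, c i ^ 2 * ∫ x, en (fun x => V x - E) (u i) x := fun c => by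
    simp_rw [← integral_const_mul]
    rw [← integral_finsetSum _ fun i _ => (en_int hW (ht i)).const_mul _]
    congr 1; ext x
    have hder : deriv (∑ i, c i • u i) x = ∑ i, c i * deriv (u i) x := by
      rw [deriv_sum fun i _ => ((ht i).c1.differentiable one_ne_zero x).const_smul (c i)]
      refine Finset.sum_congr rfl fun i _ => ?_
      rw [deriv_const_smul _ ((ht i).c1.differentiable one_ne_zero x)]
      rfl
    have hval : (∑ i, c i • u i) x = ∑ i, c i * u i x := by simp
    simp only [en]
    rw [hder, hval, sum_sq_of_orth, sum_sq_of_orth, Finset.mul_sum, ← Finset.sum_add_distrib]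
    · refine Finset.sum_congr rfl fun i _ => ?_
      ring
    · intro i j hij
      linear_combination c i * c j * o1 i j hij x
    · intro i j hij
      linear_combination c i * c j * o2 i j hij x
  have hF1 : ∀ w ∈ Submodule.span ℝ (range u), ContDiff ℝ (⊤ : ℕ∞) w ∧ HasCompactSupport w := by
    intro w hw
    obtain ⟨c, rfl⟩ := (Submodule.mem_span_range_iff_exists_fun ℝ).1 hw
    exact htc c
  have hF2 : ∀ w ∈ Submodule.span ℝ (range u), w ≠ 0 →
      (∫ x, (deriv w x ^ 2 + V x * w x ^ 2)) < E * ∫ x, w x ^ 2 := by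
    intro w hw hw0
    obtain ⟨c, rfl⟩ := (Submodule.mem_span_range_iff_exists_fun ℝ).1 hw
    have hsh := en_shift hV (htc c) E
    rw [hen c] at hsh
    have : ∑ i, c i ^ 2 * ∫ x, en (fun x => V x - E) (u i) x < 0 := by
      obtain ⟨i, hi⟩ : ∃ i, c i ≠ 0 := by
        by_contra! h
        exact hw0 (by simp [h])
      refine Finset.sum_neg' (fun j _ => ?_) ⟨i, Finset.mem_univ i, ?_⟩
      · exact mul_nonpos_of_nonneg_of_nonpos (sq_nonneg _) (hneg j).le
      · exact mul_neg_of_pos_of_neg (by positivity) (hneg i)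
    linarith
  have := le_iSup (fun F : {F : Submodule ℝ (ℝ → ℝ) //
      (∀ u ∈ F, ContDiff ℝ (⊤ : ℕ∞) u ∧ HasCompactSupport u) ∧
      (∀ u ∈ F, u ≠ 0 →
        (∫ x, (deriv u x ^ 2 + V x * u x ^ 2)) < E * ∫ x, u x ^ 2)} =>
    (Module.finrank ℝ F.1 : ℕ∞)) ⟨Submodule.span ℝ (range u), hF1, hF2⟩
  simp only [finrank_span_eq_card hli] at this
  exact this

/-- Families of disjointly supported test functions on the half line. -/
def LF (W : ℝ → ℝ) (n : ℕ) : Prop :=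
  ∃ u : Fin n → ℝ → ℝ, (∀ i, Tst (u i)) ∧ (∀ i, tsupport (u i) ⊆ Ioi 0) ∧
    (∀ i j, i ≠ j → Disjoint (tsupport (u i)) (tsupport (u j))) ∧
    ∀ i, ∫ x, en W (u i) x < 0

lemma LF.zero (W : ℝ → ℝ) : LF W 0 :=
  ⟨fun _ _ => 0, fun i => i.elim0, fun i => i.elim0, fun i => i.elim0, fun i => i.elim0⟩

lemma le_schN1_of_LF {V : ℝ → ℝ} (hV : Pot V) {E : ℝ} {n m : ℕ} (h1 : LF (fun x => V x - E) n)
    (h2 : LF (fun x => V (-x) - E) m) : ((n + m : ℕ) : ℕ∞) ≤ schN1 V E := by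
  obtain ⟨u, ut, us, ud, un⟩ := h1
  obtain ⟨v, vt, vs, vd, vn⟩ := h2
  have hts : ∀ j, tsupport (fun x => v j (-x)) = (fun x => -x) ⁻¹' tsupport (v j) := fun j =>
    tsupport_comp_eq_preimage (v j) (Homeomorph.neg ℝ)
  have hx : ∀ i j, Disjoint (tsupport (u i)) (tsupport (fun x => v j (-x))) := fun i j => by
    rw [Set.disjoint_left]
    intro x h1 h2
    rw [hts] at h2
    have a1 : 0 < x := us i h1
    have a2 : 0 < -x := vs j h2
    linarith
  have := le_schN1 hV (E := E) (ι := Fin n ⊕ Fin m)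
    (Sum.elim u (fun j x => v j (-x))) ?_ ?_ ?_
  · simpa using this
  · rintro (i | j)
    · exact ut i
    · exact ⟨(vt j).1.comp contDiff_neg, (vt j).2.comp_homeomorph (Homeomorph.neg ℝ)⟩
  · rintro (i | i) (j | j) hij
    · exact ud i j fun h => hij (by rw [h])
    · exact hx i j
    · exact (hx j i).symm
    · simp only [Sum.elim_inr, hts]
      exact (vd i j fun h => hij (by rw [h])).preimage _
  · rintro (i | j)
    · exact un i
    · simp only [Sum.elim_inr]
      have h1 := vn j
      rw [← integral_neg_eq_self] at h1
      convert h1 using 2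
      ext x
      simp only [en]
      rw [deriv_comp_neg]; simp

/-- Scaled test functions. -/
lemma lower_of_profile {V : ℝ → ℝ} (hV : Pot V) {L : ℝ}
    (hL : Tendsto (fun r : ℝ => r ^ 2 * V r) atTop (𝓝 L)) {l c : ℝ} (hl : 0 < l)
    (hc : c < -L) {w : ℝ → ℝ} (hw : Tst w) (hws : tsupport w ⊆ Ioo 1 (exp l))
    (hwn : ∫ x, (deriv w x ^ 2 - c * (w x ^ 2 / x ^ 2)) < 0) :
    ∃ C : ℝ, ∀ E : ℝ, -1 < E → E < 0 → ∃ n : ℕ, LF (fun x => V x - E) n ∧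
      |log (|E|)| / (2 * l) - C ≤ n := by
  obtain ⟨c', hc1, hc2⟩ := exists_between hc
  obtain ⟨R0, hR0⟩ := eventually_atTop.1 (hL.eventually (gt_mem_nhds (show L < -c' by linarith)))
  set R := max R0 1 with hRdef
  have hRpos : 0 < R := lt_of_lt_of_le one_pos (le_max_right _ _)
  set D := (1 / 2 * log (c' - c) - log R) / l with hD
  refine ⟨1 - D, fun E hE1 hE0 => ?_⟩
  have hEpos : 0 < |E| := abs_pos.2 hE0.ne
  have hlogE : log (|E|) < 0 := log_neg hEpos (by rw [abs_of_neg hE0]; linarith)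
  set n : ℕ := ⌊|log (|E|)| / (2 * l) + D⌋₊ with hn
  have hn1 : |log (|E|)| / (2 * l) + D < n + 1 := Nat.lt_floor_add_one _
  refine ⟨n, ?_, by linarith⟩
  set a : ℕ → ℝ := fun j => R * exp (j * l) with ha
  have hapos : ∀ j, 0 < a j := fun j => by positivity
  have hRa : ∀ j, R ≤ a j := fun j => by
    have : 1 ≤ exp (j * l) := one_le_exp (by positivity)
    simp only [ha]; nlinarith
  have hasucc : ∀ j, a (j + 1) = a j * exp l := fun j => by
    simp only [ha]; rw [mul_assoc, ← exp_add]; push_cast; ring_nf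
  have hamono : Monotone a := monotone_nat_of_le_succ fun j => by
    rw [hasucc]
    have : 1 ≤ exp l := one_le_exp hl.le
    nlinarith [hapos j]
  have hts : ∀ j x, x ∈ tsupport (fun x => w (x / a j)) → a j < x ∧ x < a (j + 1) := by
    intro j x hx
    have h1 : tsupport (fun x => w (x / a j)) ⊆ (fun x => x / a j) ⁻¹' tsupport w :=
      tsupport_comp_subset_preimage w (by fun_prop)
    have h2 := hws (h1 hx)
    simp only [mem_Ioo] at h2
    rw [one_lt_div (hapos j), div_lt_iff₀ (hapos j)] at h2
    rw [hasucc]; exact ⟨h2.1, by linarith [h2.2]⟩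
  have hT : ∀ j, Tst (fun x => w (x / a j)) := fun j => by
    refine ⟨hw.1.comp (contDiff_id.div_const _), ?_⟩
    have := hw.2.comp_homeomorph (Homeomorph.mulRight₀ (a j)⁻¹ (inv_ne_zero (hapos j).ne'))
    simpa [div_eq_mul_inv, Function.comp_def] using this
  -- pointwise bound on the potential
  have hpt : ∀ j < n, ∀ x, a j < x → x < a (j + 1) → V x - E ≤ -c / x ^ 2 := by
    intro j hj x hx1 hx2
    have hx0 : 0 < x := (hapos j).trans hx1
    have h1 : ((j + 1 : ℕ) : ℝ) ≤ |log (|E|)| / (2 * l) + D :=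
      (Nat.le_floor_iff' (Nat.succ_ne_zero j)).1 hj
    have h2 : V x ≤ -c' / x ^ 2 := by
      have := hR0 x ((le_max_left _ _).trans ((hRa j).trans hx1.le))
      rw [le_div_iff₀ (by positivity)]; linarith
    have h3 : |E| * x ^ 2 ≤ c' - c := by
      have h4 : log x ≤ log R + ((j + 1 : ℕ) : ℝ) * l := by
        have := log_le_log hx0 hx2.le
        simp only [ha] at this
        rwa [log_mul hRpos.ne' (exp_pos _).ne', log_exp] at this
      have h5 : ((j + 1 : ℕ) : ℝ) * l ≤ |log (|E|)| / 2 + (1 / 2 * log (c' - c) - log R) := by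
        refine (mul_le_mul_of_nonneg_right h1 hl.le).trans (le_of_eq ?_)
        rw [hD]; field_simp
      rw [abs_of_neg hlogE] at h5
      have hcc : 0 < c' - c := by linarith
      rw [← Real.log_le_log_iff (by positivity) hcc, log_mul hEpos.ne' (by positivity), log_pow]
      push_cast
      linarith
    have h6 : -E ≤ (c' - c) / x ^ 2 := by
      rw [le_div_iff₀ (by positivity), ← abs_of_neg hE0]; exact h3
    have h7 : -c / x ^ 2 = -c' / x ^ 2 + (c' - c) / x ^ 2 := by ring
    linarith
  refine ⟨fun j x => w (x / a j), fun j => hT j, fun j x hx => (hapos j).trans (hts j x hx).1,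
    ?_, ?_⟩
  · have key : ∀ i j : ℕ, i < j →
        Disjoint (tsupport (fun x => w (x / a i))) (tsupport (fun x => w (x / a j))) := by
      intro i j hij
      rw [Set.disjoint_left]
      intro x h1 h2
      have := hamono (Nat.succ_le_of_lt hij)
      have e1 := (hts i x h1).2
      have e2 := (hts j x h2).1
      simp only [Nat.succ_eq_add_one] at this
      linarith
    intro i j hij
    rcases lt_or_gt_of_ne (fun h => hij (Fin.ext h) : (i : ℕ) ≠ j) with h | h
    · exact key i j h
    · exact (key j i h).symm
  · intro j
    set f : ℝ → ℝ := fun y => deriv w y ^ 2 - c * (w y ^ 2 / y ^ 2) with hf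
    have hfi : Integrable f := by
      have hwc := hw.c1.continuous
      have hwd : Continuous (deriv w) := hw.c1.continuous_deriv le_rfl
      have i1 : Integrable (fun x => deriv w x ^ 2) :=
        Continuous.integrable_of_hasCompactSupport (by fun_prop) (cs_sq hw.2.deriv)
      have i2 : Integrable (fun x => w x ^ 2 / x ^ 2) := by
        refine Integrable.mono' (sq_int hw) ?_ (Eventually.of_forall fun x => ?_)
        · exact (Measurable.div (by fun_prop) (by fun_prop)).aestronglyMeasurable
        · by_cases hx : x ∈ tsupport w
          · have : 1 < x := (hws hx).1
            rw [norm_of_nonneg (by positivity)]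
            exact div_le_self (sq_nonneg _) (by nlinarith)
          · simp [image_eq_zero_of_notMem_tsupport hx]
      exact i1.sub (i2.const_mul c)
    have hder : ∀ x, deriv (fun x => w (x / a j)) x = deriv w (x / a j) / a j := fun x => by
      have h1 : HasDerivAt w (deriv w (x / a j)) (x / a j) :=
        (hw.c1.differentiable one_ne_zero _).hasDerivAt
      have h2 : HasDerivAt (fun x => x / a j) (1 / a j) x := (hasDerivAt_id x).div_const _
      have h3 : HasDerivAt (fun x => w (x / a j)) (deriv w (x / a j) * (1 / a j)) x :=
        h1.comp x h2
      rw [h3.deriv]; ring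
    have hle : ∫ x, en (fun x => V x - E) (fun x => w (x / a j)) x ≤
        ∫ x, (a j ^ 2)⁻¹ * f (x / a j) := by
      refine integral_mono (en_int (hV.sub_const E) (hT j))
        ((hfi.comp_div (hapos j).ne').const_mul _) fun x => ?_
      have haj := (hapos j).ne'
      simp only [en, hder, hf]
      by_cases hx : x ∈ tsupport (fun x => w (x / a j))
      · obtain ⟨e1, e2⟩ := hts j x hx
        have hx0 : x ≠ 0 := ((hapos j).trans e1).ne'
        have := mul_le_mul_of_nonneg_right (hpt j j.2 x e1 e2) (sq_nonneg (w (x / a j)))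
        have e3 : (a j ^ 2)⁻¹ * (deriv w (x / a j) ^ 2 - c * (w (x / a j) ^ 2 / (x / a j) ^ 2)) =
          (deriv w (x / a j) / a j) ^ 2 + -c / x ^ 2 * w (x / a j) ^ 2 := by
          field_simp
          ring
        rw [e3]; linarith
      · have : w (x / a j) = 0 :=
          image_eq_zero_of_notMem_tsupport (f := fun x => w (x / a j)) hx
        rw [this]
        apply le_of_eq
        simp only [ne_eq, OfNat.ofNat_ne_zero, not_false_eq_true, zero_pow, zero_div, mul_zero]
        ring
    refine hle.trans_lt ?_
    rw [integral_const_mul, Measure.integral_comp_div, smul_eq_mul]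
    refine mul_neg_of_pos_of_neg (inv_pos.2 (pow_pos (hapos j) 2)) ?_
    exact mul_neg_of_pos_of_neg (abs_pos.2 (hapos j).ne') hwn

lemma profile_cutoff {l c b δ : ℝ} (hδ : 0 < δ)
    (g G : ℝ → ℝ) (hgs : ∀ x, 0 < x → ContDiffAt ℝ (⊤ : ℕ∞) g x)
    (hg : ∀ x, 0 < x → HasDerivAt g (G x) x)
    (hG : ∀ x, 0 < x → HasDerivAt G (-((1 / 4 + b ^ 2) * (g x / x ^ 2))) x)
    (χ χ' : ℝ → ℝ) (hχ : ContDiff ℝ (⊤ : ℕ∞) χ) (hχd : ∀ x, HasDerivAt χ (χ' x) x)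
    (hχc : Continuous χ')
    (h1 : ∀ x, x ≤ 1 + δ → χ x = 0) (h2 : ∀ x, exp l - δ ≤ x → χ x = 0) (hl : 0 < l) :
    Tst (fun x => χ x * g x) ∧ tsupport (fun x => χ x * g x) ⊆ Ioo 1 (exp l) ∧
    ∫ x, (deriv (fun x => χ x * g x) x ^ 2 - c * ((χ x * g x) ^ 2 / x ^ 2)) =
      ∫ x in (1:ℝ)..(exp l), ((χ' x * g x) ^ 2
        - (c - (1 / 4 + b ^ 2)) * (χ x ^ 2 * (g x ^ 2 / x ^ 2))) := by
  have hρ : 1 ≤ exp l := one_le_exp hl.le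
  have hts : tsupport (fun x => χ x * g x) ⊆ Icc (1 + δ) (exp l - δ) := by
    refine closure_minimal (fun x hx => ?_) isClosed_Icc
    have hx' : χ x ≠ 0 := left_ne_zero_of_mul hx
    constructor
    · by_contra h; exact hx' (h1 x (not_le.1 h).le)
    · by_contra h; exact hx' (h2 x (not_le.1 h).le)
  have hts' : tsupport (fun x => χ x * g x) ⊆ Ioo 1 (exp l) := fun x hx => by
    have := hts hx
    exact ⟨by linarith [this.1], by linarith [this.2]⟩
  have hT : Tst (fun x => χ x * g x) := by
    refine ⟨?_, HasCompactSupport.of_support_subset_isCompact isCompact_Icc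
      ((subset_tsupport _).trans hts)⟩
    rw [contDiff_iff_contDiffAt]
    intro x
    rcases lt_or_ge 0 x with hx | hx
    · exact hχ.contDiffAt.mul (hgs x hx)
    · have : (fun x => χ x * g x) =ᶠ[𝓝 x] fun _ => 0 := by
        filter_upwards [gt_mem_nhds (show x < 1 by linarith)] with y hy
        rw [h1 y (by linarith), zero_mul]
      exact contDiffAt_const.congr_of_eventuallyEq this
  refine ⟨hT, hts', ?_⟩
  have e1 : ∫ x, (deriv (fun x => χ x * g x) x ^ 2 - c * ((χ x * g x) ^ 2 / x ^ 2)) =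
      ∫ x in (1:ℝ)..(exp l), (deriv (fun x => χ x * g x) x ^ 2 - c * ((χ x * g x) ^ 2 / x ^ 2)) := by
    rw [intervalIntegral.integral_of_le hρ, setIntegral_eq_integral_of_forall_compl_eq_zero]
    intro x hx
    have hx' : x ∉ tsupport (fun x => χ x * g x) := fun h => hx ⟨(hts' h).1, (hts' h).2.le⟩
    have hd : deriv (fun x => χ x * g x) x = 0 := by
      by_contra h0
      exact hx' (support_deriv_subset h0)
    have hv : χ x * g x = 0 :=
      image_eq_zero_of_notMem_tsupport (f := fun x => χ x * g x) hx'
    rw [hd, hv]; simp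
  have hpos : ∀ x ∈ Icc 1 (exp l), 0 < x := fun x hx => one_pos.trans_le hx.1
  have hne : ∀ x ∈ Icc 1 (exp l), x ^ 2 ≠ 0 := fun x hx => pow_ne_zero _ (hpos x hx).ne'
  have cg : ContinuousOn g (Icc 1 (exp l)) := fun x hx =>
    (hg x (hpos x hx)).continuousAt.continuousWithinAt
  have cG : ContinuousOn G (Icc 1 (exp l)) := fun x hx =>
    (hG x (hpos x hx)).continuousAt.continuousWithinAt
  have cχ : Continuous χ := hχ.continuous
  set D : ℝ → ℝ := fun x => (2 * χ x * χ' x) * (g x * G x) +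
    χ x ^ 2 * (G x * G x + g x * -((1 / 4 + b ^ 2) * (g x / x ^ 2))) with hD
  have iD : IntervalIntegrable D volume 1 (exp l) := by
    apply ContinuousOn.intervalIntegrable
    rw [uIcc_of_le hρ]
    fun_prop (disch := assumption)
  have iM : IntervalIntegrable (fun x => (χ' x * g x) ^ 2
        - (c - (1 / 4 + b ^ 2)) * (χ x ^ 2 * (g x ^ 2 / x ^ 2))) volume 1 (exp l) := by
    apply ContinuousOn.intervalIntegrable
    rw [uIcc_of_le hρ]
    fun_prop (disch := assumption)
  have e2 : ∫ x in (1:ℝ)..(exp l), D x = 0 := by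
    rw [intervalIntegral.integral_eq_sub_of_hasDerivAt (f := fun x => χ x ^ 2 * (g x * G x)) _ iD]
    · rw [h1 1 (by linarith), h2 (exp l) (by linarith)]; simp
    · intro x hx
      rw [uIcc_of_le hρ] at hx
      have := ((hχd x).pow 2).mul ((hg x (hpos x hx)).mul (hG x (hpos x hx)))
      refine this.congr_deriv ?_
      simp only [hD, Pi.pow_apply, Pi.mul_apply]
      norm_num
  rw [e1, ← add_zero (∫ x in (1:ℝ)..(exp l), ((χ' x * g x) ^ 2
        - (c - (1 / 4 + b ^ 2)) * (χ x ^ 2 * (g x ^ 2 / x ^ 2)))), ← e2,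
    ← intervalIntegral.integral_add iM iD]
  refine intervalIntegral.integral_congr fun x hx => ?_
  rw [uIcc_of_le hρ] at hx
  have hd : deriv (fun x => χ x * g x) x = χ' x * g x + χ x * G x :=
    ((hχd x).mul (hg x (hpos x hx))).deriv
  simp only [hd, hD]
  have := (hpos x hx).ne'
  ring

lemma deriv_T_zero {y : ℝ} (hy : y < 0 ∨ 1 < y) : deriv smoothTransition y = 0 := by
  rcases hy with hy | hy
  · have : smoothTransition =ᶠ[𝓝 y] fun _ => 0 := by
      filter_upwards [gt_mem_nhds hy] with z hz
      exact smoothTransition.zero_of_nonpos hz.le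
    rw [this.deriv_eq]; simp
  · have : smoothTransition =ᶠ[𝓝 y] fun _ => 1 := by
      filter_upwards [lt_mem_nhds hy] with z hz
      exact smoothTransition.one_of_one_le hz.le
    rw [this.deriv_eq]; simp

lemma T_smooth : ContDiff ℝ (⊤ : ℕ∞) smoothTransition := smoothTransition.contDiff

lemma T_cd : Continuous (deriv smoothTransition) :=
  T_smooth.continuous_deriv (by exact_mod_cast le_top)

lemma T_bound : ∃ B : ℝ, 0 ≤ B ∧ ∀ y, |deriv smoothTransition y * (y + 1)| ≤ B := by
  have hc : Continuous (fun y => deriv smoothTransition y * (y + 1)) :=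
    T_cd.mul (by fun_prop)
  obtain ⟨B, hB⟩ := isCompact_Icc.exists_bound_of_continuousOn (s := Icc (0:ℝ) 1) hc.continuousOn
  have hB0 : 0 ≤ B := (norm_nonneg _).trans (hB 0 (by simp))
  refine ⟨B, hB0, fun y => ?_⟩
  by_cases hy : y ∈ Icc (0:ℝ) 1
  · exact hB y hy
  · rw [deriv_T_zero, zero_mul, abs_zero]
    · exact hB0
    · by_contra! h; exact hy ⟨h.1, h.2⟩

set_option maxHeartbeats 1000000 in
lemma profile {l c : ℝ} (hl : 0 < l) (hc : 1 / 4 + (π / l) ^ 2 < c) :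
    ∃ w : ℝ → ℝ, Tst w ∧ tsupport w ⊆ Ioo 1 (exp l) ∧
      ∫ x, (deriv w x ^ 2 - c * (w x ^ 2 / x ^ 2)) < 0 := by
  set b := π / l with hb
  have hbpos : 0 < b := by positivity
  have hbl : b * l = π := by rw [hb]; field_simp
  have hρ : 1 < exp l := one_lt_exp_iff.2 hl
  set g : ℝ → ℝ := fun x => sqrt x * sin (b * log x) with hgdef
  set G : ℝ → ℝ := fun x => (1 / 2 * sin (b * log x) + b * cos (b * log x)) / sqrt x with hGdef
  have hgs : ∀ x, 0 < x → ContDiffAt ℝ (⊤ : ℕ∞) g x := fun x hx =>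
    (contDiffAt_sqrt hx.ne').mul
      (contDiff_sin.contDiffAt.comp x (contDiffAt_const.mul (contDiffAt_log.2 hx.ne')))
  have hlog : ∀ x, 0 < x → HasDerivAt (fun x => b * log x) (b * x⁻¹) x := fun x hx =>
    (hasDerivAt_log hx.ne').const_mul b
  have hg : ∀ x, 0 < x → HasDerivAt g (G x) x := fun x hx => by
    have := (hasDerivAt_sqrt hx.ne').mul (hlog x hx).sin
    refine this.congr_deriv ?_
    have hs : 0 < sqrt x := sqrt_pos.2 hx
    have hss : x = sqrt x ^ 2 := (sq_sqrt hx.le).symm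
    simp only [hGdef]
    generalize b * log x = z
    generalize sqrt x = s at *
    subst hss
    field_simp
  have hG : ∀ x, 0 < x → HasDerivAt G (-((1 / 4 + b ^ 2) * (g x / x ^ 2))) x := fun x hx => by
    have hs : 0 < sqrt x := sqrt_pos.2 hx
    have := (((hlog x hx).sin.const_mul (1 / 2)).add ((hlog x hx).cos.const_mul b)).div
      (hasDerivAt_sqrt hx.ne') hs.ne'
    refine this.congr_deriv ?_
    have hss : x = sqrt x ^ 2 := (sq_sqrt hx.le).symm
    simp only [hgdef, Pi.add_apply]
    generalize b * log x = z
    generalize sqrt x = s at *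
    subst hss
    field_simp
    ring
  have hg1 : g 1 = 0 := by simp [hgdef]
  have hgρ : g (exp l) = 0 := by simp [hgdef, hbl]
  have hpos : ∀ x ∈ Icc 1 (exp l), 0 < x := fun x hx => one_pos.trans_le hx.1
  have hne : ∀ x ∈ Icc 1 (exp l), x ^ 2 ≠ 0 := fun x hx => pow_ne_zero _ (hpos x hx).ne'
  have cg : ContinuousOn g (Icc 1 (exp l)) := fun x hx =>
    (hg x (hpos x hx)).continuousAt.continuousWithinAt
  have cG : ContinuousOn G (Icc 1 (exp l)) := fun x hx =>
    (hG x (hpos x hx)).continuousAt.continuousWithinAt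
  obtain ⟨K, hK⟩ := isCompact_Icc.exists_bound_of_continuousOn cG
  obtain ⟨P, hP⟩ := isCompact_Icc.exists_bound_of_continuousOn cg
  have hK0 : 0 ≤ K := (norm_nonneg _).trans (hK 1 ⟨le_rfl, hρ.le⟩)
  have hlip : ∀ x ∈ Icc 1 (exp l), ∀ y ∈ Icc 1 (exp l), |g y - g x| ≤ K * |y - x| :=
    fun x hx y hy => (convex_Icc 1 (exp l)).norm_image_sub_le_of_norm_hasDerivWithin_le
      (fun z hz => (hg z (hpos z hz)).hasDerivWithinAt) hK hx hy
  have hb1 : ∀ x ∈ Icc 1 (exp l), |g x| ≤ K * (x - 1) := fun x hx => by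
    have := hlip 1 ⟨le_rfl, hρ.le⟩ x hx
    rwa [hg1, sub_zero, abs_of_nonneg (by linarith [hx.1] : 0 ≤ x - 1)] at this
  have hb2 : ∀ x ∈ Icc 1 (exp l), |g x| ≤ K * (exp l - x) := fun x hx => by
    have := hlip x hx (exp l) ⟨hρ.le, le_rfl⟩
    rwa [hgρ, zero_sub, abs_neg, abs_of_nonneg (by linarith [hx.2] : 0 ≤ exp l - x)] at this
  obtain ⟨B, hB0, hB⟩ := T_bound
  set T := smoothTransition with hTdef
  set T' := deriv smoothTransition with hT'def
  have hTd : ∀ y, HasDerivAt T (T' y) y := fun y =>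
    (T_smooth.differentiable (by simp) y).hasDerivAt
  set χ : ℝ → ℝ → ℝ := fun δ x => T ((x - 1) / δ - 1) * T ((exp l - x) / δ - 1) with hχ
  set χ' : ℝ → ℝ → ℝ := fun δ x => T' ((x - 1) / δ - 1) * (1 / δ) * T ((exp l - x) / δ - 1) +
    T ((x - 1) / δ - 1) * (T' ((exp l - x) / δ - 1) * (-1 / δ)) with hχ'
  have cT : Continuous T := T_smooth.continuous
  have cT' : Continuous T' := T_cd
  have hχs : ∀ δ, ContDiff ℝ (⊤ : ℕ∞) (χ δ) := fun δ =>
    (T_smooth.comp (by fun_prop)).mul (T_smooth.comp (by fun_prop))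
  have hχc : ∀ δ, Continuous (χ δ) := fun δ => (hχs δ).continuous
  have hχ'c : ∀ δ, Continuous (χ' δ) := fun δ => by simp only [hχ']; fun_prop
  have hχd : ∀ δ x, HasDerivAt (χ δ) (χ' δ x) x := fun δ x => by
    have a1 : HasDerivAt (fun x => (x - 1) / δ - 1) (1 / δ) x :=
      (((hasDerivAt_id x).sub_const 1).div_const δ).sub_const 1
    have a2 : HasDerivAt (fun x => (exp l - x) / δ - 1) (-1 / δ) x :=
      (((hasDerivAt_id x).const_sub (exp l)).div_const δ).sub_const 1
    exact ((hTd _).comp x a1).mul ((hTd _).comp x a2)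
  have hT0 : ∀ y, 0 ≤ T y := smoothTransition.nonneg
  have hT1 : ∀ y, T y ≤ 1 := smoothTransition.le_one
  set F : ℝ → ℝ → ℝ := fun δ x => (χ' δ x * g x) ^ 2
        - (c - (1 / 4 + b ^ 2)) * (χ δ x ^ 2 * (g x ^ 2 / x ^ 2)) with hF
  have hcc : 0 < c - (1 / 4 + b ^ 2) := by linarith
  have hlim : Tendsto (fun δ => ∫ x in (1:ℝ)..(exp l), F δ x) (𝓝[>] 0)
      (𝓝 (∫ x in (1:ℝ)..(exp l), -((c - (1 / 4 + b ^ 2)) * (g x ^ 2 / x ^ 2)))) := by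
    refine intervalIntegral.tendsto_integral_filter_of_dominated_convergence
      (fun _ => (2 * (K * B)) ^ 2 + (c - (1 / 4 + b ^ 2)) * P ^ 2) ?_ ?_ (by simp) ?_
    · refine Eventually.of_forall fun δ => ?_
      have h1 := hχc δ
      have h2 := hχ'c δ
      rw [uIoc_of_le hρ.le]
      refine (ContinuousOn.mono ?_ Ioc_subset_Icc_self).aestronglyMeasurable measurableSet_Ioc
      simp only [hF]
      fun_prop (disch := assumption)
    · filter_upwards [self_mem_nhdsWithin] with δ hδ
      have hδ : 0 < δ := hδ
      refine Eventually.of_forall fun x hx => ?_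
      rw [uIoc_of_le hρ.le] at hx
      have hx' : x ∈ Icc 1 (exp l) := ⟨hx.1.le, hx.2⟩
      have t1 : |T' ((x - 1) / δ - 1) * (1 / δ) * T ((exp l - x) / δ - 1) * g x| ≤ K * B := by
        have q1 := hB ((x - 1) / δ - 1)
        have q2 := hb1 x hx'
        rw [sub_add_cancel, abs_mul, abs_of_nonneg (div_nonneg (by linarith [hx.1]) hδ.le)] at q1
        rw [abs_mul, abs_mul, abs_mul, abs_of_nonneg (hT0 _),
          abs_of_nonneg (show 0 ≤ 1 / δ by positivity)]
        calc _ ≤ |T' ((x - 1) / δ - 1)| * (1 / δ) * 1 * (K * (x - 1)) := by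
              gcongr; exact hT1 _
          _ = K * (|T' ((x - 1) / δ - 1)| * ((x - 1) / δ)) := by ring
          _ ≤ K * B := by gcongr
      have t2 : |T ((x - 1) / δ - 1) * (T' ((exp l - x) / δ - 1) * (-1 / δ)) * g x| ≤ K * B := by
        have q1 := hB ((exp l - x) / δ - 1)
        have q2 := hb2 x hx'
        rw [sub_add_cancel, abs_mul, abs_of_nonneg (div_nonneg (by linarith [hx.2]) hδ.le)] at q1
        rw [abs_mul, abs_mul, abs_mul, abs_of_nonneg (hT0 _), neg_div, abs_neg,
          abs_of_nonneg (show 0 ≤ 1 / δ by positivity)]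
        calc _ ≤ 1 * (|T' ((exp l - x) / δ - 1)| * (1 / δ)) * (K * (exp l - x)) := by
              gcongr; exact hT1 _
          _ = K * (|T' ((exp l - x) / δ - 1)| * ((exp l - x) / δ)) := by ring
          _ ≤ K * B := by gcongr
      have t3 : |χ' δ x * g x| ≤ 2 * (K * B) := by
        simp only [hχ', add_mul]
        exact (abs_add_le _ _).trans (by linarith)
      have t4 : (χ' δ x * g x) ^ 2 ≤ (2 * (K * B)) ^ 2 := by
        rw [← sq_abs]; gcongr
      have t5 : χ δ x ^ 2 * (g x ^ 2 / x ^ 2) ≤ P ^ 2 := by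
        have r1 : χ δ x ^ 2 ≤ 1 := by
          have r0 : 0 ≤ χ δ x := mul_nonneg (hT0 _) (hT0 _)
          have : χ δ x ≤ 1 := mul_le_one₀ (hT1 _) (hT0 _) (hT1 _)
          nlinarith
        have r2 : g x ^ 2 / x ^ 2 ≤ P ^ 2 := by
          refine (div_le_self (sq_nonneg _) (by nlinarith [hx.1])).trans ?_
          have := hP x hx'
          rw [Real.norm_eq_abs] at this
          rw [← sq_abs]; gcongr
        calc _ ≤ 1 * P ^ 2 := by gcongr
          _ = _ := one_mul _
      have t6 : 0 ≤ χ δ x ^ 2 * (g x ^ 2 / x ^ 2) := by positivity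
      have t7 := mul_le_mul_of_nonneg_left t5 hcc.le
      have t8 := mul_nonneg hcc.le t6
      have t9 := sq_nonneg (χ' δ x * g x)
      rw [Real.norm_eq_abs, abs_le]
      simp only [hF]
      constructor <;> nlinarith [sq_nonneg (2 * (K * B)), mul_nonneg hcc.le (sq_nonneg P)]
    · refine Eventually.of_forall fun x hx => ?_
      rw [uIoc_of_le hρ.le] at hx
      rcases eq_or_lt_of_le hx.2 with hxe | hxl
      · have : g x = 0 := by rw [hxe, hgρ]
        simp only [hF, this]
        simp
      · refine tendsto_const_nhds.congr' ?_
        have m : 0 < min ((x - 1) / 3) ((exp l - x) / 3) := by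
          apply lt_min <;> linarith [hx.1]
        filter_upwards [self_mem_nhdsWithin, mem_nhdsWithin_of_mem_nhds (gt_mem_nhds m)]
          with δ hδ hδm
        have hδ : 0 < δ := hδ
        obtain ⟨m1, m2⟩ := lt_min_iff.1 hδm
        have y1 : 1 < (x - 1) / δ - 1 := by
          rw [lt_sub_iff_add_lt, lt_div_iff₀ hδ]; linarith
        have y2 : 1 < (exp l - x) / δ - 1 := by
          rw [lt_sub_iff_add_lt, lt_div_iff₀ hδ]; linarith
        have z1 : T' ((x - 1) / δ - 1) = 0 := deriv_T_zero (Or.inr y1)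
        have z2 : T' ((exp l - x) / δ - 1) = 0 := deriv_T_zero (Or.inr y2)
        have z3 : T ((x - 1) / δ - 1) = 1 := smoothTransition.one_of_one_le y1.le
        have z4 : T ((exp l - x) / δ - 1) = 1 := smoothTransition.one_of_one_le y2.le
        simp only [hF, hχ, hχ', z1, z2, z3, z4]
        ring
  have hneg : ∫ x in (1:ℝ)..(exp l), -((c - (1 / 4 + b ^ 2)) * (g x ^ 2 / x ^ 2)) < 0 := by
    rw [intervalIntegral.integral_neg, neg_lt_zero]
    refine intervalIntegral.intervalIntegral_pos_of_pos_on ?_ (fun x hx => ?_) hρ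
    · apply ContinuousOn.intervalIntegrable
      rw [uIcc_of_le hρ.le]
      fun_prop (disch := assumption)
    · have hx0 : 0 < x := one_pos.trans hx.1
      have h1 : 0 < log x := log_pos hx.1
      have h2 : log x < l := (log_lt_iff_lt_exp hx0).2 hx.2
      have h3 : 0 < sin (b * log x) := sin_pos_of_pos_of_lt_pi (by positivity) (by
        rw [← hbl]; gcongr)
      have h4 : 0 < g x := mul_pos (sqrt_pos.2 hx0) h3
      positivity
  obtain ⟨δ, hδn, hδ⟩ := ((hlim.eventually (gt_mem_nhds hneg)).and self_mem_nhdsWithin).exists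
  have hδ : 0 < δ := hδ
  obtain ⟨c1, c2, c3⟩ := profile_cutoff (c := c) (b := b) hδ g G hgs hg hG (χ δ) (χ' δ) (hχs δ)
    (hχd δ) (hχ'c δ)
    (fun x hx => by
      have : T ((x - 1) / δ - 1) = 0 := smoothTransition.zero_of_nonpos (by
        rw [sub_nonpos, div_le_one hδ]; linarith)
      simp only [hχ, this, zero_mul])
    (fun x hx => by
      have : T ((exp l - x) / δ - 1) = 0 := smoothTransition.zero_of_nonpos (by
        rw [sub_nonpos, div_le_one hδ]; linarith)
      simp only [hχ, this, mul_zero]) hl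
  exact ⟨_, c1, c2, by rw [c3]; exact hδn⟩

lemma upper_rate {V : ℝ → ℝ} (hV : Pot V) {L : ℝ}
    (hL : Tendsto (fun r : ℝ => r ^ 2 * V r) atTop (𝓝 L)) {s : ℝ}
    (h : sqrt (max (-(L + 1 / 4)) 0) / π < s) :
    ∃ C : ℝ, ∀ E : ℝ, -1 < E → E < 0 → ∃ n : ℕ, HL (fun x => V x - E) n ∧
      (n : ℝ) ≤ s / 2 * |log (|E|)| + C := by
  have hs : 0 < s := lt_of_le_of_lt (by positivity) h
  obtain ⟨C, hC⟩ := upper_right hV hL (l := 1 / s) (by positivity) (by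
    rw [div_lt_iff₀ pi_pos] at h
    rw [div_div_eq_mul_div, div_one]; linarith)
  refine ⟨C, fun E h1 h2 => ?_⟩
  obtain ⟨n, hn, hle⟩ := hC E h1 h2
  refine ⟨n, hn, hle.trans (le_of_eq ?_)⟩
  field_simp

lemma lower_rate {V : ℝ → ℝ} (hV : Pot V) {L : ℝ}
    (hL : Tendsto (fun r : ℝ => r ^ 2 * V r) atTop (𝓝 L)) {s : ℝ}
    (h : s < sqrt (max (-(L + 1 / 4)) 0) / π) :
    ∃ C : ℝ, ∀ E : ℝ, -1 < E → E < 0 → ∃ n : ℕ, LF (fun x => V x - E) n ∧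
      s / 2 * |log (|E|)| - C ≤ n := by
  rcases le_or_gt s 0 with hs | hs
  · refine ⟨0, fun E _ _ => ⟨0, LF.zero _, ?_⟩⟩
    have := mul_nonneg (neg_nonneg.2 hs) (abs_nonneg (log (|E|)))
    push_cast; linarith
  · rw [lt_div_iff₀ pi_pos, Real.lt_sqrt (by positivity)] at h
    have h1 : (s * π) ^ 2 < -(L + 1 / 4) := by
      rcases lt_max_iff.1 h with h | h
      · exact h
      · exact absurd h (not_lt.2 (sq_nonneg _))
    obtain ⟨c, hc1, hc2⟩ := exists_between (show 1 / 4 + (s * π) ^ 2 < -L by linarith)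
    obtain ⟨w, w1, w2, w3⟩ := profile (l := 1 / s) (c := c) (by positivity) (by
      rw [div_div_eq_mul_div, div_one, mul_comm π s]; exact hc1)
    obtain ⟨C, hC⟩ := lower_of_profile hV hL (l := 1 / s) (by positivity) hc2 w1 w2 w3
    refine ⟨C, fun E h1 h2 => ?_⟩
    obtain ⟨n, hn, hle⟩ := hC E h1 h2
    refine ⟨n, hn, le_trans (le_of_eq ?_) hle⟩
    field_simp

lemma tendsto_abs_log : Tendsto (fun E : ℝ => |log (|E|)|) (𝓝[<] 0) atTop := by
  have h1 : Tendsto log (𝓝[<] (0:ℝ)) atBot :=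
    Real.tendsto_log_nhdsNE_zero.mono_left (nhdsWithin_mono _ fun x hx => ne_of_lt hx)
  simp only [Real.log_abs]
  exact tendsto_abs_atBot_atTop.comp h1

/-- Proposition 2.3 for `d = 1`: logarithmic eigenvalue asymptotics for potentials with
`r² V(rω) → L(ω)`, and finiteness of the discrete spectrum when `min L > -1/4`. -/
theorem log_eigenvalue_asymptotics_dim_one
    (V : ℝ → ℝ) (hVmeas : Measurable V) (M : ℝ) (hVbd : ∀ x, |V x| ≤ M)
    (L1 Lm : ℝ)
    (hL1 : Tendsto (fun r : ℝ => r ^ 2 * V r) atTop (𝓝 L1))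
    (hLm : Tendsto (fun r : ℝ => r ^ 2 * V (-r)) atTop (𝓝 Lm)) :
    ((∀ᶠ E in 𝓝[<] (0 : ℝ), schN1 V E ≠ ⊤) ∧
      Tendsto (fun E : ℝ => ((schN1 V E).toNat : ℝ) / |Real.log (|E|)|)
        (𝓝[<] 0)
        (𝓝 ((1 / (2 * π)) *
          (Real.sqrt (max (-(L1 + 1 / 4)) 0) + Real.sqrt (max (-(Lm + 1 / 4)) 0))))) ∧
    (-(1 / 4 : ℝ) < min L1 Lm → schN1 V 0 < ⊤) := by
  have hV : Pot V := ⟨hVmeas, M, hVbd⟩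
  have hV' := hV.comp_neg
  have hev : ∀ᶠ E in 𝓝[<] (0 : ℝ), -1 < E ∧ E < 0 := by
    filter_upwards [mem_nhdsWithin_of_mem_nhds (lt_mem_nhds (by norm_num : (-1:ℝ) < 0)),
      self_mem_nhdsWithin] with E e1 e2
    exact ⟨e1, e2⟩
  set σ1 := sqrt (max (-(L1 + 1 / 4)) 0) / π with hσ1
  set σ2 := sqrt (max (-(Lm + 1 / 4)) 0) / π with hσ2
  have htgt : (1 / (2 * π)) *
      (Real.sqrt (max (-(L1 + 1 / 4)) 0) + Real.sqrt (max (-(Lm + 1 / 4)) 0)) =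
      σ1 / 2 + σ2 / 2 := by
    rw [hσ1, hσ2]; field_simp
  have hup : ∀ s1 s2 : ℝ, σ1 < s1 → σ2 < s2 → ∃ C : ℝ, ∀ E : ℝ, -1 < E → E < 0 →
      schN1 V E ≠ ⊤ ∧ ((schN1 V E).toNat : ℝ) ≤ (s1 / 2 + s2 / 2) * |log (|E|)| + C := by
    intro s1 s2 h1 h2
    obtain ⟨C1, hC1⟩ := upper_rate hV hL1 h1
    obtain ⟨C2, hC2⟩ := upper_rate hV' hLm h2
    refine ⟨C1 + C2 + 1, fun E e1 e2 => ?_⟩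
    obtain ⟨n, hn, hn'⟩ := hC1 E e1 e2
    obtain ⟨m, hm, hm'⟩ := hC2 E e1 e2
    have hle := schN1_le hV hn hm
    refine ⟨ne_top_of_le_ne_top (ENat.natCast_ne_top _) hle, ?_⟩
    have h3 : (schN1 V E).toNat ≤ n + m + 1 := ENat.toNat_le_of_le_natCast hle
    have h4 : ((schN1 V E).toNat : ℝ) ≤ n + m + 1 := by exact_mod_cast h3
    linarith
  have hfin : ∀ᶠ E in 𝓝[<] (0 : ℝ), schN1 V E ≠ ⊤ := by
    obtain ⟨C, hC⟩ := hup (σ1 + 1) (σ2 + 1) (by linarith) (by linarith)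
    filter_upwards [hev] with E hE
    exact (hC E hE.1 hE.2).1
  refine ⟨⟨hfin, ?_⟩, ?_⟩
  · rw [htgt, tendsto_order]
    constructor
    · intro a ha
      set e := σ1 / 2 + σ2 / 2 - a with he
      obtain ⟨C1, hC1⟩ := lower_rate hV hL1 (s := σ1 - e / 2) (by
        rw [← hσ1]; linarith)
      obtain ⟨C2, hC2⟩ := lower_rate hV' hLm (s := σ2 - e / 2) (by
        rw [← hσ2]; linarith)
      filter_upwards [hev, hfin, tendsto_abs_log.eventually_gt_atTop 0,
        tendsto_abs_log.eventually_gt_atTop ((C1 + C2) / (e / 2))] with E hE hf hp hb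
      obtain ⟨n, hn, hn'⟩ := hC1 E hE.1 hE.2
      obtain ⟨m, hm, hm'⟩ := hC2 E hE.1 hE.2
      have h3 : n + m ≤ (schN1 V E).toNat := by
        have := le_schN1_of_LF hV hn hm
        rw [← ENat.natCast_toNat hf] at this
        exact_mod_cast this
      have h4 : (n : ℝ) + m ≤ ((schN1 V E).toNat : ℝ) := by exact_mod_cast h3
      rw [lt_div_iff₀ hp]
      rw [div_lt_iff₀ (by linarith)] at hb
      generalize |log (|E|)| = t at *
      have : a * t = (σ1 - e / 2) / 2 * t + (σ2 - e / 2) / 2 * t - t * (e / 2) := by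
        rw [he]; ring
      linarith
    · intro a ha
      set e := a - (σ1 / 2 + σ2 / 2) with he
      obtain ⟨C, hC⟩ := hup (σ1 + e / 2) (σ2 + e / 2) (by linarith) (by linarith)
      filter_upwards [hev, tendsto_abs_log.eventually_gt_atTop 0,
        tendsto_abs_log.eventually_gt_atTop (C / (e / 2))] with E hE hp hb
      have h4 := (hC E hE.1 hE.2).2
      rw [div_lt_iff₀ hp]
      rw [div_lt_iff₀ (by linarith)] at hb
      generalize |log (|E|)| = t at *
      have : a * t = ((σ1 + e / 2) / 2 + (σ2 + e / 2) / 2) * t + t * (e / 2) := by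
        rw [he]; ring
      linarith
  · intro h
    obtain ⟨h1, h2⟩ := lt_min_iff.1 h
    obtain ⟨n, hn⟩ := HL_zero hV hL1 h1
    obtain ⟨m, hm⟩ := HL_zero hV' hLm h2
    refine (schN1_le hV (E := 0) (n := n) (m := m) ?_ ?_).trans_lt (ENat.natCast_lt_top _)
    · simpa using hn
    · simpa using hm

end
end

section
/- Let d ≥ 1 and ρ ∈ (0,2). Let V : ℝ^d → ℝ be measurable, and assume there exist constants C, C', R ∈ (0,∞) such that |V(x)| ≤ C(1+|x|)^{-ρ} for all x ∈ ℝ^d and V(x) ≤ -C'|x|^{-ρ} for all |x| ≥ R. For E < 0 and ε > -1 set N_cl(E; (1+ε)V) := (τ_d/(2π)^d)∫_{ℝ^d}((1+ε)V(x)-E)_-^{d/2}dx. Then lim_{ε→0} limsup_{E↑0} | N_cl(E;(1+ε)V) / N_cl(E;V) - 1 | = 0. -/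
open MeasureTheory Filter Real Set Topology

noncomputable section

abbrev Ed (d : ℕ) := EuclideanSpace ℝ (Fin d)

/-- Glazman variational count of eigenvalues of `-Δ + V` below `E`. -/
noncomputable def schN (d : ℕ) (V : Ed d → ℝ) (E : ℝ) : ℕ∞ :=
  ⨆ F : {F : Submodule ℝ (Ed d → ℝ) //
      (∀ u ∈ F, ContDiff ℝ (⊤ : ℕ∞) u ∧ HasCompactSupport u) ∧
      (∀ u ∈ F, u ≠ 0 →
        (∫ x, (‖gradient u x‖ ^ 2 + V x * u x ^ 2)) < E * ∫ x, u x ^ 2)},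
    (Module.finrank ℝ F.1 : ℕ∞)

/-- Laplacian. -/
noncomputable def lap (d : ℕ) (φ : Ed d → ℝ) (x : Ed d) : ℝ :=
  ∑ i : Fin d, iteratedFDeriv ℝ 2 φ x ![EuclideanSpace.single i 1, EuclideanSpace.single i 1]

/-- The symbol class `S_{m,ρ}`. -/
def SClass (d m : ℕ) (ρ : ℝ) (W : Ed d → ℝ) : Prop :=
  ContDiff ℝ m W ∧ ∃ C : ℝ, 0 < C ∧ ∀ k : ℕ, k ≤ m → ∀ x : Ed d,
    ‖iteratedFDeriv ℝ k W x‖ ≤ C * (1 + ‖x‖) ^ (-ρ - (k : ℝ))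

/-- The cube `(-R/2, R/2)^d`. -/
def cube (d : ℕ) (R : ℝ) : Set (Ed d) := {x | ∀ i, |x i| < R / 2}

/-- Admissibility of `η` with mean value `η₀` witnessed by the solution `φ` of `Δφ = η - η₀`. -/
structure IsAdmissible (d : ℕ) (η : Ed d → ℝ) (η₀ : ℝ) (φ : Ed d → ℝ) : Prop where
  background_ne : ∃ x, η x ≠ η₀
  smooth : ContDiff ℝ 2 φ
  bounded : ∀ k : ℕ, k ≤ 2 → ∃ M : ℝ, ∀ x, ‖iteratedFDeriv ℝ k φ x‖ ≤ M
  poisson : ∀ x, lap d φ x = η x - η₀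
  normalized : Filter.limsup (fun R : ℝ => (∫ x in cube d R, φ x) / R ^ d) Filter.atTop = 0

/-- Volume of the unit ball of `ℝ^d`. -/
noncomputable def tau (d : ℕ) : ℝ := (volume (Metric.ball (0 : Ed d) 1)).toReal

/-- Semiclassical counting function. -/
noncomputable def Ncl (d : ℕ) (V : Ed d → ℝ) (E : ℝ) : ℝ :=
  (tau d / (2 * π) ^ d) * ∫ x, (max (E - V x) 0) ^ ((d : ℝ) / 2)


/-- Continuity of the semiclassical counting function under small dilations of the coupling
constant: `lim_{ε→0} limsup_{E↑0} |N_cl(E;(1+ε)V)/N_cl(E;V) - 1| = 0`. -/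
lemma aux_unif (p : ℝ) (hp : 0 < p) (η : ℝ) (hη : 0 < η) :
    ∃ δ : ℝ, 0 < δ ∧ δ ≤ 1 ∧ ∀ ε : ℝ, |ε| < δ → ∀ v E : ℝ, E < 0 →
      |(max (E - (1 + ε) * v) 0) ^ p - (max (E - v) 0) ^ p| ≤ η * |v| ^ p := by
  have hc : UniformContinuousOn (fun t : ℝ => t ^ p) (Icc 0 2) :=
    isCompact_Icc.uniformContinuousOn_of_continuous
      (continuous_id.rpow_const (fun _ => Or.inr hp.le)).continuousOn
  obtain ⟨δ, hδ, h⟩ := Metric.uniformContinuousOn_iff.1 hc η hη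
  refine ⟨min δ 1, lt_min hδ one_pos, min_le_right _ _, fun ε hε v E hE => ?_⟩
  have hε1 : |ε| < δ := hε.trans_le (min_le_left _ _)
  have hε2 := abs_lt.1 (hε.trans_le (min_le_right _ _))
  rcases eq_or_ne v 0 with rfl | hv
  · simp [max_eq_right hE.le, Real.zero_rpow hp.ne']
  have ha : 0 < |v| := abs_pos.2 hv
  have key : ∀ c : ℝ, max (E - c * v) 0 = |v| * max (E / |v| - c * (v / |v|)) 0 := by
    intro c
    rw [mul_max_of_nonneg _ _ ha.le, mul_zero]
    congr 1
    field_simp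
  have hw : abs (v / abs v) = 1 := by rw [abs_div, abs_abs, div_self ha.ne']
  set w := v / |v| with hwdef
  have hEv : E / |v| < 0 := div_neg_of_neg_of_pos hE ha
  have hwb := abs_le.1 hw.le
  have mem : ∀ c : ℝ, 0 ≤ c → c ≤ 2 → max (E / |v| - c * w) 0 ∈ Icc (0:ℝ) 2 := by
    intro c h0 h2
    refine ⟨le_max_right _ _, max_le ?_ (by norm_num)⟩
    nlinarith
  have k1 := key (1 + ε)
  have k2 := key 1
  rw [one_mul] at k2
  rw [k1, k2, Real.mul_rpow ha.le (le_max_right _ _), Real.mul_rpow ha.le (le_max_right _ _),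
    ← mul_sub, abs_mul, abs_of_nonneg (Real.rpow_nonneg ha.le p), mul_comm]
  refine mul_le_mul_of_nonneg_right ?_ (Real.rpow_nonneg ha.le p)
  have := h _ (mem (1 + ε) (by linarith) (by linarith)) _ (mem 1 (by norm_num) (by norm_num)) (by
    rw [Real.dist_eq]
    refine (abs_max_sub_max_le_abs _ _ _).trans_lt ?_
    have : E / |v| - (1 + ε) * w - (E / |v| - 1 * w) = -(ε * w) := by ring
    rw [this, abs_neg, abs_mul, hw, mul_one]
    exact hε1)
  rw [Real.dist_eq] at this
  exact this.le

lemma aux_radial (d : ℕ) (hd : 1 ≤ d) (s : ℝ) (hs : s < d) (T : ℝ) (hT : 0 < T) :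
    Integrable (fun x : Ed d => (Iio T).indicator (fun y : ℝ => y ^ (-s)) ‖x‖) ∧
    ∫ x : Ed d, (Iio T).indicator (fun y : ℝ => y ^ (-s)) ‖x‖
      = (d * tau d / (d - s)) * T ^ ((d : ℝ) - s) := by
  have : Nonempty (Fin d) := ⟨⟨0, hd⟩⟩
  have hcongr : ∀ y ∈ Ioi (0:ℝ), y ^ (d - 1) • (Iio T).indicator (fun y : ℝ => y ^ (-s)) y
      = (Ioo 0 T).indicator (fun y : ℝ => y ^ ((d:ℝ) - 1 - s)) y := by
    intro y hy
    have hy' : (0:ℝ) < y := hy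
    by_cases h : y < T
    · rw [indicator_of_mem (show y ∈ Iio T from h), indicator_of_mem (show y ∈ Ioo 0 T from ⟨hy, h⟩),
        smul_eq_mul, ← Real.rpow_natCast, ← Real.rpow_add hy', Nat.cast_sub hd]
      congr 1
      push_cast; ring
    · rw [indicator_of_notMem (show y ∉ Iio T from h),
        indicator_of_notMem (show y ∉ Ioo 0 T from fun h' => h h'.2), smul_zero]
  have hI : IntegrableOn (fun y : ℝ => y ^ ((d:ℝ) - 1 - s)) (Ioo 0 T) := by
    rw [intervalIntegral.integrableOn_Ioo_rpow_iff hT]; linarith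
  constructor
  · rw [integrable_fun_norm_addHaar volume (E := Ed d) (f := (Iio T).indicator (fun y : ℝ => y ^ (-s)))]
    rw [finrank_euclideanSpace_fin, integrableOn_congr_fun hcongr measurableSet_Ioi]
    exact ((integrable_indicator_iff measurableSet_Ioo).2 hI).integrableOn
  · rw [integral_fun_norm_addHaar volume (E := Ed d) ((Iio T).indicator (fun y : ℝ => y ^ (-s))),
      finrank_euclideanSpace_fin, setIntegral_congr_fun measurableSet_Ioi hcongr,
      setIntegral_indicator measurableSet_Ioo,
      inter_eq_self_of_subset_right (fun y hy => hy.1), ← integral_Ioc_eq_integral_Ioo,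
      ← intervalIntegral.integral_of_le hT.le, integral_rpow (Or.inl (by linarith))]
    have e : (d:ℝ) - 1 - s + 1 = d - s := by ring
    rw [e, Real.zero_rpow (by linarith), sub_zero, nsmul_eq_mul, smul_eq_mul]
    simp only [tau, Measure.real]
    ring

lemma aux_tau_pos (d : ℕ) : 0 < tau d :=
  ENNReal.toReal_pos (Metric.measure_ball_pos _ _ one_pos).ne' measure_ball_lt_top.ne

lemma aux_main
    (d : ℕ) (hd : 1 ≤ d) (ρ : ℝ) (hρ : ρ ∈ Set.Ioo (0 : ℝ) 2)
    (V : Ed d → ℝ) (hVmeas : Measurable V)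
    (C C' R : ℝ) (hC : 0 < C) (hC' : 0 < C') (hR : 0 < R)
    (hbd : ∀ x : Ed d, |V x| ≤ C * (1 + ‖x‖) ^ (-ρ))
    (hneg : ∀ x : Ed d, R ≤ ‖x‖ → V x ≤ -C' * ‖x‖ ^ (-ρ)) :
    ∃ K c r0 : ℝ, 0 ≤ K ∧ 0 < c ∧ 0 < r0 ∧ ∀ η : ℝ, 0 < η → ∃ δ : ℝ, 0 < δ ∧ ∀ ε : ℝ, |ε| < δ →
      ∀ r : ℝ, r0 ≤ r →
      c * r ^ ((d:ℝ) - ρ * (d / 2)) ≤ ∫ x, (max (-r ^ (-ρ) - V x) 0) ^ ((d : ℝ) / 2) ∧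
      |(∫ x, (max (-r ^ (-ρ) - (1 + ε) * V x) 0) ^ ((d : ℝ) / 2))
        - ∫ x, (max (-r ^ (-ρ) - V x) 0) ^ ((d : ℝ) / 2)| ≤
        η * (K * r ^ ((d:ℝ) - ρ * (d / 2))) := by
  obtain ⟨hρ0, hρ2⟩ := hρ
  have : Nonempty (Fin d) := ⟨⟨0, hd⟩⟩
  have hd0 : (0:ℝ) < d := by exact_mod_cast hd
  set p : ℝ := (d:ℝ) / 2 with hp
  have hp0 : 0 < p := by positivity
  have hs : ρ * p < d := by rw [hp]; nlinarith
  set q : ℝ := (d:ℝ) - ρ * p with hq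
  have hq0 : 0 < q := by linarith
  set α : ℝ := (C' / 2) ^ (1 / ρ) with hα
  set β : ℝ := (2 * C) ^ (1 / ρ) with hβ
  have hα0 : 0 < α := by positivity
  have hβ0 : 0 < β := by positivity
  have hαρ : α ^ (-ρ) = 2 / C' := by
    rw [hα, ← Real.rpow_mul (by positivity), show 1 / ρ * -ρ = -1 by field_simp, Real.rpow_neg_one,
      inv_div]
  have hβρ : β ^ (-ρ) = 1 / (2 * C) := by
    rw [hβ, ← Real.rpow_mul (by positivity), show 1 / ρ * -ρ = -1 by field_simp, Real.rpow_neg_one,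
      one_div]
  have hτ := aux_tau_pos d
  set M : ℝ := d * tau d / (d - ρ * p) with hM
  have hM0 : 0 < M := by positivity
  -- pointwise bound on V
  have hV : ∀ x : Ed d, x ≠ 0 → |V x| ≤ C * ‖x‖ ^ (-ρ) := by
    intro x hx
    refine (hbd x).trans (mul_le_mul_of_nonneg_left ?_ hC.le)
    exact Real.rpow_le_rpow_of_nonpos (norm_pos_iff.2 hx) (by linarith) (by linarith)
  have hae : ∀ᵐ x : Ed d, x ≠ 0 := by
    rw [ae_iff]; simp
  refine ⟨C ^ p * (M * β ^ q), tau d * α ^ (d:ℝ) / 2, max 1 (2 * R / α), by positivity,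
    by positivity, by positivity, fun η hη => ?_⟩
  obtain ⟨δ, hδ0, hδ1, hδ⟩ := aux_unif p hp0 η hη
  refine ⟨δ, hδ0, fun ε hε r hr => ?_⟩
  have hr1 : 1 ≤ r := (le_max_left _ _).trans hr
  have hrR : 2 * R ≤ α * r := by
    have := (le_max_right _ _).trans hr
    rw [div_le_iff₀ hα0] at this
    linarith
  have hr0 : 0 < r := by linarith
  have hl0 : 0 < r ^ (-ρ) := by positivity
  obtain ⟨hGi, hGe⟩ := aux_radial d hd (ρ * p) hs (β * r) (by positivity)
  set G : Ed d → ℝ := fun x => (Iio (β * r)).indicator (fun y : ℝ => y ^ (-(ρ * p))) ‖x‖ with hG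
  have hεb := abs_lt.1 (hε.trans_le hδ1)
  -- vanishing outside
  have hvan : ∀ c : ℝ, 0 ≤ c → c ≤ 2 → ∀ x : Ed d, β * r ≤ ‖x‖ →
      max (-r ^ (-ρ) - c * V x) 0 = 0 := by
    intro c hc0 hc2 x hx
    have hx0 : x ≠ 0 := norm_pos_iff.1 (lt_of_lt_of_le (by positivity) hx)
    apply max_eq_right
    have h1 : ‖x‖ ^ (-ρ) ≤ (β * r) ^ (-ρ) :=
      Real.rpow_le_rpow_of_nonpos (by positivity) hx (by linarith)
    rw [Real.mul_rpow hβ0.le hr0.le, hβρ] at h1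
    have h2 := hV x hx0
    have h3 : C * ‖x‖ ^ (-ρ) ≤ r ^ (-ρ) / 2 := by
      calc _ ≤ C * (1 / (2 * C) * r ^ (-ρ)) := mul_le_mul_of_nonneg_left h1 hC.le
        _ = _ := by field_simp
    have h4 := neg_abs_le (V x)
    nlinarith [abs_nonneg (V x)]
  have hpow : ∀ x : Ed d, x ≠ 0 → |V x| ^ p ≤ C ^ p * ‖x‖ ^ (-(ρ * p)) := by
    intro x hx
    calc |V x| ^ p ≤ (C * ‖x‖ ^ (-ρ)) ^ p := Real.rpow_le_rpow (abs_nonneg _) (hV x hx) hp0.le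
      _ = _ := by
        rw [Real.mul_rpow hC.le (by positivity), ← Real.rpow_mul (norm_nonneg _), neg_mul]
  have hint : ∀ c : ℝ, 0 ≤ c → c ≤ 2 →
      Integrable (fun x : Ed d => (max (-r ^ (-ρ) - c * V x) 0) ^ p) := by
    intro c hc0 hc2
    refine Integrable.mono' (hGi.const_mul (2 ^ p * C ^ p)) ?_ ?_
    · exact (((measurable_const.sub (hVmeas.const_mul c)).max measurable_const).pow_const
        p).aestronglyMeasurable
    · filter_upwards [hae] with x hx
      rw [Real.norm_of_nonneg (by positivity)]
      by_cases h : ‖x‖ < β * r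
      · simp only [hG]
        rw [indicator_of_mem (show ‖x‖ ∈ Iio (β * r) from h), mul_assoc]
        refine le_trans ?_ (mul_le_mul_of_nonneg_left (hpow x hx) (by positivity))
        rw [← Real.mul_rpow (by norm_num) (abs_nonneg _)]
        refine Real.rpow_le_rpow (le_max_right _ _) (max_le ?_ (by positivity)) hp0.le
        have h4 := neg_abs_le (V x)
        nlinarith [abs_nonneg (V x)]
      · rw [hvan c hc0 hc2 x (not_lt.1 h), Real.zero_rpow hp0.ne']
        simp only [hG]
        rw [indicator_of_notMem (show ‖x‖ ∉ Iio (β * r) from h), mul_zero]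
  have hi1 := hint 1 (by norm_num) (by norm_num)
  simp only [one_mul] at hi1
  have hi2 := hint (1 + ε) (by linarith) (by linarith)
  constructor
  · -- lower bound
    set A : Set (Ed d) := Metric.ball 0 (α * r) \ Metric.ball 0 R with hA
    have hAm : MeasurableSet A := measurableSet_ball.diff measurableSet_ball
    have hAfin : volume A ≠ ⊤ :=
      (lt_of_le_of_lt (measure_mono sdiff_subset) measure_ball_lt_top).ne
    have hlow : (r ^ (-ρ)) ^ p * volume.real A ≤ ∫ x, (max (-r ^ (-ρ) - V x) 0) ^ p := by
      calc (r ^ (-ρ)) ^ p * volume.real A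
          ≤ ∫ x in A, (max (-r ^ (-ρ) - V x) 0) ^ p := by
            refine setIntegral_ge_of_const_le_real hAm hAfin ?_ hi1.integrableOn
            intro x hx
            have hx1 : ‖x‖ < α * r := by simpa using hx.1
            have hx2 : R ≤ ‖x‖ := by simpa using hx.2
            refine Real.rpow_le_rpow hl0.le (le_max_of_le_left ?_) hp0.le
            have h1 := hneg x hx2
            have h2 : (α * r) ^ (-ρ) ≤ ‖x‖ ^ (-ρ) :=
              Real.rpow_le_rpow_of_nonpos (by linarith) hx1.le (by linarith)
            rw [Real.mul_rpow hα0.le hr0.le, hαρ] at h2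
            have h3 := mul_le_mul_of_nonneg_left h2 hC'.le
            have h4 : C' * (2 / C' * r ^ (-ρ)) = 2 * r ^ (-ρ) := by field_simp
            linarith
        _ ≤ _ := setIntegral_le_integral hi1 (Eventually.of_forall fun x => by positivity)
    refine le_trans ?_ hlow
    have hball : ∀ t : ℝ, 0 ≤ t → volume.real (Metric.ball (0 : Ed d) t) = t ^ d * tau d := by
      intro t ht
      rw [Measure.real, Measure.addHaar_ball volume _ ht, ENNReal.toReal_mul,
        ENNReal.toReal_ofReal (by positivity), finrank_euclideanSpace_fin, tau]
    have hvol : volume.real A = (α * r) ^ d * tau d - R ^ d * tau d := by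
      rw [hA, measureReal_sdiff (Metric.ball_subset_ball (by linarith)) measurableSet_ball
        measure_ball_lt_top.ne, hball _ (by positivity), hball _ hR.le]
    have hRd : 2 * R ^ d ≤ (α * r) ^ d := by
      calc 2 * R ^ d ≤ 2 ^ d * R ^ d := by
            refine mul_le_mul_of_nonneg_right ?_ (by positivity)
            calc (2:ℝ) = 2 ^ 1 := by norm_num
              _ ≤ 2 ^ d := pow_le_pow_right₀ (by norm_num) hd
        _ = (2 * R) ^ d := by rw [mul_pow]
        _ ≤ _ := pow_le_pow_left₀ (by positivity) hrR d
    have hrq : r ^ q = (r ^ (-ρ)) ^ p * r ^ d := by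
      rw [← Real.rpow_mul hr0.le, ← Real.rpow_natCast r d, ← Real.rpow_add hr0, hq]
      congr 1; ring
    rw [hvol, hrq, Real.rpow_natCast]
    have h5 : tau d * α ^ d / 2 * ((r ^ (-ρ)) ^ p * r ^ d)
        = (r ^ (-ρ)) ^ p * (tau d * ((α * r) ^ d / 2)) := by rw [mul_pow]; ring
    rw [h5]
    refine mul_le_mul_of_nonneg_left ?_ (by positivity)
    nlinarith
  · rw [← integral_sub hi2 hi1, ← Real.norm_eq_abs]
    refine (norm_integral_le_of_norm_le (hGi.const_mul (η * C ^ p)) ?_).trans ?_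
    · filter_upwards [hae] with x hx
      rw [Real.norm_eq_abs]
      by_cases h : ‖x‖ < β * r
      · refine (hδ ε hε (V x) (-r ^ (-ρ)) (by linarith)).trans ?_
        simp only [hG]
        rw [indicator_of_mem (show ‖x‖ ∈ Iio (β * r) from h), mul_assoc]
        exact mul_le_mul_of_nonneg_left (hpow x hx) hη.le
      · have e1 := hvan 1 (by norm_num) (by norm_num) x (not_lt.1 h)
        rw [one_mul] at e1
        rw [hvan (1 + ε) (by linarith) (by linarith) x (not_lt.1 h), e1]
        simp only [hG]
        rw [indicator_of_notMem (show ‖x‖ ∉ Iio (β * r) from h)]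
        simp
    · rw [integral_const_mul, hGe, Real.mul_rpow hβ0.le hr0.le]
      apply le_of_eq; ring

theorem semiclassical_counting_coupling_continuity
    (d : ℕ) (hd : 1 ≤ d) (ρ : ℝ) (hρ : ρ ∈ Set.Ioo (0 : ℝ) 2)
    (V : Ed d → ℝ) (hVmeas : Measurable V)
    (C C' R : ℝ) (hC : 0 < C) (hC' : 0 < C') (hR : 0 < R)
    (hbd : ∀ x : Ed d, |V x| ≤ C * (1 + ‖x‖) ^ (-ρ))
    (hneg : ∀ x : Ed d, R ≤ ‖x‖ → V x ≤ -C' * ‖x‖ ^ (-ρ)) :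
    Tendsto (fun ε : ℝ =>
        Filter.limsup
          (fun E : ℝ => |Ncl d (fun x => (1 + ε) * V x) E / Ncl d V E - 1|) (𝓝[<] 0))
      (𝓝[≠] (0 : ℝ)) (𝓝 0) := by

  obtain ⟨K, c, r0, hK, hc, hr0, H⟩ := aux_main d hd ρ hρ V hVmeas C C' R hC hC' hR hbd hneg
  have hρ0 := hρ.1
  rw [Metric.tendsto_nhds]
  intro κ hκ
  have hK1 : 0 < K + 1 := by linarith
  obtain ⟨δ, hδ0, hδ⟩ := H (κ / 2 * c / (K + 1)) (by positivity)
  have hmem : ∀ᶠ ε : ℝ in 𝓝[≠] (0:ℝ), |ε| < δ := by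
    refine mem_nhdsWithin_of_mem_nhds ?_
    filter_upwards [Metric.ball_mem_nhds (0:ℝ) hδ0] with ε hε
    simpa using hε
  filter_upwards [hmem] with ε hε
  set u : ℝ → ℝ := fun E => |Ncl d (fun x => (1 + ε) * V x) E / Ncl d V E - 1| with hu
  have hle : ∀ᶠ E in 𝓝[<] (0:ℝ), u E ≤ κ / 2 := by
    have hneg0 : -r0 ^ (-ρ) < 0 := by
      have : 0 < r0 ^ (-ρ) := by positivity
      linarith
    filter_upwards [Ioo_mem_nhdsLT hneg0] with E hE
    obtain ⟨hE1, hE2⟩ := hE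
    set r : ℝ := (-E) ^ (-(1 / ρ)) with hr
    have hE0 : 0 < -E := by linarith
    have hrp : 0 < r := by positivity
    have hrE : -r ^ (-ρ) = E := by
      rw [hr, ← Real.rpow_mul hE0.le, show -(1 / ρ) * -ρ = 1 by field_simp, Real.rpow_one]
      ring
    have hrr : r0 ≤ r := by
      by_contra hlt
      have := Real.rpow_le_rpow_of_nonpos hrp (not_le.1 hlt).le (by linarith : -ρ ≤ 0)
      linarith
    obtain ⟨h1, h2⟩ := hδ ε hε r hrr
    rw [hrE] at h1 h2
    have hq : 0 < r ^ ((d:ℝ) - ρ * (d / 2)) := by positivity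
    set Q := r ^ ((d:ℝ) - ρ * (d / 2))
    simp only [hu, Ncl]
    have hpre : tau d / (2 * π) ^ d ≠ 0 := by
      have := aux_tau_pos d
      positivity
    rw [mul_div_mul_left _ _ hpre]
    set I0 := ∫ x, (max (E - V x) 0) ^ ((d : ℝ) / 2)
    set I1 := ∫ x, (max (E - (1 + ε) * V x) 0) ^ ((d : ℝ) / 2)
    have hI0 : 0 < I0 := lt_of_lt_of_le (by positivity) h1
    rw [div_sub_one hI0.ne', abs_div, abs_of_pos hI0, div_le_iff₀ hI0]
    calc |I1 - I0| ≤ κ / 2 * c / (K + 1) * (K * Q) := h2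
      _ = κ / 2 * (c * Q) * (K / (K + 1)) := by field_simp
      _ ≤ κ / 2 * (c * Q) * 1 := by
        refine mul_le_mul_of_nonneg_left ?_ (by positivity)
        rw [div_le_one hK1]; linarith
      _ ≤ κ / 2 * I0 := by
        rw [mul_one]; exact mul_le_mul_of_nonneg_left h1 (by positivity)
  have hge : ∀ E, 0 ≤ u E := fun E => abs_nonneg _
  have hbdd : IsBoundedUnder (· ≤ ·) (𝓝[<] (0:ℝ)) u := ⟨κ / 2, by simpa using hle⟩
  have hbdd2 : IsBoundedUnder (· ≥ ·) (𝓝[<] (0:ℝ)) u := ⟨0, by simp [hge]⟩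
  have hub : limsup u (𝓝[<] (0:ℝ)) ≤ κ / 2 := limsup_le_of_le hbdd2.isCoboundedUnder_le hle
  have hlb : 0 ≤ limsup u (𝓝[<] (0:ℝ)) :=
    le_limsup_of_frequently_le (Eventually.frequently (Eventually.of_forall hge)) hbdd
  rw [Real.dist_eq, sub_zero, abs_of_nonneg hlb]
  linarith

end
end
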